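/- arXiv:1911.03566 — 10 statements merged into one kernel-verified Lean document; each statement's English description precedes it below -/
import Mathlib

section
/- Let t ≥ 1 and let H be a full, finitely generated additive submonoid of ℕ^t, and let a be an atom of H with divisor sequence (s_n(a))_{n≥1}. Then: (1) s_1(a) = 1; (2) s_n(a) ≠ 2 for every n ≥ 1; (3) s_n(a) ≤ s_{n+1}(a) for every n ≥ 1; and (4) there exists N ≥ 1 such that s_n(a) = s_N(a) for all n ≥ N. -/
/-- `a` is an atom (irreducible element) of the additive submonoid `H`. -/
def IsAtomOf {M : Type*} [AddCommMonoid M] (H : AddSubmonoid M) (a : M) : Prop :=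
  a ∈ H ∧ a ≠ 0 ∧ ∀ b c : M, b ∈ H → c ∈ H → a = b + c → b = 0 ∨ c = 0

/-- `b` divides `v` in the additive submonoid `H`. -/
def DividesIn {M : Type*} [AddCommMonoid M] (H : AddSubmonoid M) (b v : M) : Prop :=
  ∃ c ∈ H, v = b + c

/-- `sSeq H a n` is the number of atoms of `H` dividing `n • a` in `H`
(the `n`th entry of the divisor sequence of `a`). -/
noncomputable def sSeq {M : Type*} [AddCommMonoid M] (H : AddSubmonoid M) (a : M) (n : ℕ) : ℕ :=
  {b : M | IsAtomOf H b ∧ DividesIn H b (n • a)}.ncard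

/-- `H` is a full submonoid of `ι → ℕ`. -/
def IsFull {ι : Type*} (H : AddSubmonoid (ι → ℕ)) : Prop :=
  ∀ u ∈ H, ∀ v ∈ H, u ≤ v → v - u ∈ H

/-- Coordinatewise coercion `(ι → ℕ) → (ι → ℤ)`. -/
def natIntMap {ι : Type*} : (ι → ℕ) → (ι → ℤ) := fun f i => (f i : ℤ)

/-- `H` is a normal submonoid of `ι → ℕ`. -/
def IsNormal {ι : Type*} (H : AddSubmonoid (ι → ℕ)) : Prop :=
  ∀ g : ι → ℤ, g ∈ AddSubgroup.closure (natIntMap '' (H : Set (ι → ℕ))) →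
    (∃ N : ℕ, 1 ≤ N ∧ N • g ∈ natIntMap '' (H : Set (ι → ℕ))) →
    g ∈ natIntMap '' (H : Set (ι → ℕ))

/-- Outer (tensor) product of two vectors of naturals. -/
def outer {t₁ t₂ : ℕ} (u : Fin t₁ → ℕ) (v : Fin t₂ → ℕ) : Fin t₁ × Fin t₂ → ℕ :=
  fun p => u p.1 * v p.2

/-- The glom `G(H₁, H₂)`: the additive submonoid generated by
`x₀ ⊠ y₀`, `xᵢ ⊠ y₀` and `x₀ ⊠ yⱼ`. -/
def glom {t₁ t₂ m n' : ℕ} (x : Fin (m + 1) → Fin t₁ → ℕ) (y : Fin (n' + 1) → Fin t₂ → ℕ) :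
    AddSubmonoid (Fin t₁ × Fin t₂ → ℕ) :=
  AddSubmonoid.closure
    (Set.range (fun i => outer (x i) (y 0)) ∪ Set.range (fun j => outer (x 0) (y j)))

/-- An atom of a reduced multiplicative monoid. -/
def IsMulAtom {H : Type*} [CommMonoid H] (a : H) : Prop :=
  a ≠ 1 ∧ ∀ b c : H, a = b * c → b = 1 ∨ c = 1

/-- The monoid `H` of multisets over `P` whose image under `φ` sums to zero. -/
def Hmon {P : Type*} {G : Type*} [AddCommGroup G] (φ : P → G) : AddSubmonoid (Multiset P) where
  carrier := {x | (x.map φ).sum = 0}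
  zero_mem' := by simp
  add_mem' := by
    intro a b ha hb
    simp only [Set.mem_setOf_eq, Multiset.map_add, Multiset.sum_add] at *
    rw [ha, hb, add_zero]

/-- The block monoid of zero-sum multisets over `G` supported in `S`. -/
def Bmon {G : Type*} [AddCommGroup G] (S : Set G) : AddSubmonoid (Multiset G) where
  carrier := {y | (∀ g ∈ y, g ∈ S) ∧ y.sum = 0}
  zero_mem' := by simp
  add_mem' := by
    intro a b ha hb
    refine ⟨fun g hg => ?_, ?_⟩
    · rcases Multiset.mem_add.mp hg with h | h
      exacts [ha.1 g h, hb.1 g h]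
    · rw [Multiset.sum_add, ha.2, hb.2, add_zero]

/-- The block monoid `B(ℤ_n, {1, m})`. -/
def blockMon (n m : ℕ) : AddSubmonoid (Multiset (ZMod n)) where
  carrier := {A | (∀ g ∈ A, g = (1 : ZMod n) ∨ g = (m : ZMod n)) ∧ A.sum = 0}
  zero_mem' := by simp
  add_mem' := by
    intro a b ha hb
    refine ⟨fun g hg => ?_, ?_⟩
    · rcases Multiset.mem_add.mp hg with h | h
      exacts [ha.1 g h, hb.1 g h]
    · rw [Multiset.sum_add, ha.2, hb.2, add_zero]

/-- The submonoid `{(x, y, z) ∈ ℕ³ : x + y = 2z}`. -/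
def H19 : AddSubmonoid (ℕ × ℕ × ℕ) where
  carrier := {p | p.1 + p.2.1 = 2 * p.2.2}
  zero_mem' := by simp
  add_mem' := by
    intro p q hp hq
    simp only [Set.mem_setOf_eq, Prod.fst_add, Prod.snd_add] at *
    omega

theorem IsAtomOf.mem_of_mem_closure {M : Type*} [AddCommMonoid M] {S : Set M} {a : M}
    (ha : IsAtomOf (AddSubmonoid.closure S) a) : a ∈ S := by
  have key : ∀ x ∈ AddSubmonoid.closure S, IsAtomOf (AddSubmonoid.closure S) x → x ∈ S := by
    intro x hx
    induction hx using AddSubmonoid.closure_induction with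
    | mem x hx => exact fun _ => hx
    | zero => exact fun h => absurd rfl h.2.1
    | add x y hx hy ihx ihy =>
      intro h
      rcases h.2.2 x y hx hy rfl with rfl | rfl
      · rw [zero_add] at h ⊢
        exact ihy h
      · rw [add_zero] at h ⊢
        exact ihx h
  exact key a ha.1 ha

theorem DividesIn.trans_add {M : Type*} [AddCommMonoid M] {H : AddSubmonoid M} {b u v : M}
    (h : DividesIn H b u) (hv : v ∈ H) : DividesIn H b (u + v) := by
  obtain ⟨c, hc, rfl⟩ := h
  exact ⟨c + v, H.add_mem hc hv, add_assoc _ _ _⟩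

theorem mem_closure_atoms_dividing {ι : Type*} [Fintype ι] (H : AddSubmonoid (ι → ℕ))
    (h : ι → ℕ) (hh : h ∈ H) :
    h ∈ AddSubmonoid.closure {b | IsAtomOf H b ∧ DividesIn H b h} := by
  induction hn : ∑ i, h i using Nat.strong_induction_on generalizing h with
  | _ n ih =>
    have sum_pos : ∀ x : ι → ℕ, x ≠ 0 → 0 < ∑ i, x i := by
      intro x hx
      obtain ⟨i, hi⟩ := Function.ne_iff.mp hx
      exact Finset.sum_pos' (fun _ _ => Nat.zero_le _)
        ⟨i, Finset.mem_univ i, Nat.pos_of_ne_zero hi⟩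
    by_cases h0 : h = 0
    · rw [h0]
      exact zero_mem _
    by_cases hat : IsAtomOf H h
    · exact AddSubmonoid.subset_closure ⟨hat, 0, H.zero_mem, (add_zero h).symm⟩
    · have hsplit : ∃ u v : ι → ℕ, u ∈ H ∧ v ∈ H ∧ h = u + v ∧ u ≠ 0 ∧ v ≠ 0 := by
        by_contra hcon
        refine hat ⟨hh, h0, fun u v hu hv huv => ?_⟩
        by_contra hne
        rw [not_or] at hne
        exact hcon ⟨u, v, hu, hv, huv, hne.1, hne.2⟩
      obtain ⟨u, v, hu, hv, rfl, hu0, hv0⟩ := hsplit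
      have hpu := sum_pos u hu0
      have hpv := sum_pos v hv0
      simp only [Pi.add_apply, Finset.sum_add_distrib] at hn
      refine add_mem
        (AddSubmonoid.closure_mono ?_ (ih (∑ i, u i) (by omega) u hu rfl))
        (AddSubmonoid.closure_mono ?_ (ih (∑ i, v i) (by omega) v hv rfl))
      · exact fun b hb => ⟨hb.1, hb.2.trans_add hv⟩
      · exact fun b hb => ⟨hb.1, add_comm v u ▸ hb.2.trans_add hu⟩

theorem IsFull.atom_eq_of_le {ι : Type*} {H : AddSubmonoid (ι → ℕ)} (hfull : IsFull H)
    {a b : ι → ℕ} (ha : IsAtomOf H a) (hb : IsAtomOf H b) (hle : a ≤ b) : a = b := by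
  have hadd : a + (b - a) = b := add_tsub_cancel_of_le hle
  rcases hb.2.2 a (b - a) ha.1 (hfull a ha.1 b hb.1 hle) hadd.symm with h | h
  · exact absurd h ha.2.1
  · rw [← hadd, h, add_zero]

theorem IsFull.atom_eq_of_nsmul_eq {ι : Type*} {H : AddSubmonoid (ι → ℕ)} (hfull : IsFull H)
    {a b : ι → ℕ} (ha : IsAtomOf H a) (hb : IsAtomOf H b) {m k : ℕ} (hm : 0 < m)
    (hk : 0 < k) (h : m • a = k • b) : a = b := by
  have hi : ∀ i, m * a i = k * b i := fun i => congrFun h i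
  rcases le_total m k with hmk | hkm
  · refine (hfull.atom_eq_of_le hb ha fun i => ?_).symm
    exact Nat.le_of_mul_le_mul_left
      ((Nat.mul_le_mul_right (b i) hmk).trans (hi i).ge) hm
  · refine hfull.atom_eq_of_le ha hb fun i => ?_
    exact Nat.le_of_mul_le_mul_left
      ((Nat.mul_le_mul_right (a i) hkm).trans (hi i).le) hk

theorem AddSubmonoid.FG.finite_atoms {M : Type*} [AddCommMonoid M] {H : AddSubmonoid M}
    (hfg : H.FG) : {b | IsAtomOf H b}.Finite := by
  obtain ⟨S, rfl⟩ := hfg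
  exact S.finite_toSet.subset fun b hb => hb.mem_of_mem_closure

theorem sSeq_one {M : Type*} [AddCommMonoid M] (H : AddSubmonoid M) {a : M}
    (ha : IsAtomOf H a) : sSeq H a 1 = 1 := by
  rw [sSeq, Set.ncard_eq_one]
  refine ⟨a, Set.eq_singleton_iff_unique_mem.mpr
    ⟨⟨ha, 0, H.zero_mem, by rw [one_nsmul, add_zero]⟩, ?_⟩⟩
  rintro b ⟨hb, c, hc, h⟩
  rw [one_nsmul] at h
  rcases ha.2.2 b c hb.1 hc h with h0 | h0
  · exact absurd h0 hb.2.1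
  · rw [h, h0, add_zero]

theorem sSeq_monotone {M : Type*} [AddCommMonoid M] {H : AddSubmonoid M} (hfg : H.FG)
    {a : M} (ha : a ∈ H) : Monotone (sSeq H a) := by
  refine monotone_nat_of_le_succ fun n => ?_
  refine Set.ncard_le_ncard (fun b hb => ⟨hb.1, ?_⟩)
    (hfg.finite_atoms.subset fun b hb => hb.1)
  rw [succ_nsmul]
  exact hb.2.trans_add ha

theorem sSeq_ne_two {ι : Type*} [Fintype ι] {H : AddSubmonoid (ι → ℕ)} (hfull : IsFull H)
    {a : ι → ℕ} (ha : IsAtomOf H a) {n : ℕ} (hn : 1 ≤ n) : sSeq H a n ≠ 2 := by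
  intro h2
  have hmem : a ∈ {b | IsAtomOf H b ∧ DividesIn H b (n • a)} := by
    refine ⟨ha, (n - 1) • a, H.nsmul_mem ha.1 _, ?_⟩
    rw [← succ_nsmul', Nat.sub_add_cancel hn]
  obtain ⟨b, hba, hset⟩ : ∃ b, b ≠ a ∧
      {b | IsAtomOf H b ∧ DividesIn H b (n • a)} = {a, b} := by
    obtain ⟨x, y, hxy, hset⟩ := Set.ncard_eq_two.mp h2
    rw [hset] at hmem
    rcases hmem with rfl | rfl
    · exact ⟨y, hxy.symm, hset⟩
    · exact ⟨x, hxy, hset.trans (Set.pair_comm _ _)⟩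
  obtain ⟨hb, c, hc, hbc⟩ : b ∈ {b | IsAtomOf H b ∧ DividesIn H b (n • a)} :=
    hset ▸ Set.mem_insert_of_mem a rfl
  have hcl : c ∈ AddSubmonoid.closure {a, b} := by
    rw [← hset]
    refine AddSubmonoid.closure_mono ?_ (mem_closure_atoms_dividing H c hc)
    refine fun d hd => ⟨hd.1, ?_⟩
    rw [hbc, add_comm]
    exact hd.2.trans_add hb.1
  obtain ⟨i, j, rfl⟩ := (AddSubmonoid.mem_closure_pair a b c).mp hcl
  have hcoord : ∀ p, n * a p = b p + (i * a p + j * b p) := fun p => congrFun hbc p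
  have hin : i < n := by
    by_contra! hle
    refine hb.2.1 (funext fun p => ?_)
    have := hcoord p
    have := Nat.mul_le_mul_right (a p) hle
    simp only [Pi.zero_apply]
    omega
  obtain ⟨m, rfl⟩ := Nat.exists_eq_add_of_lt hin
  refine hba (hfull.atom_eq_of_nsmul_eq ha hb (m := m + 1) (k := j + 1)
    m.succ_pos j.succ_pos (funext fun p => ?_)).symm
  have := hcoord p
  simp only [Pi.smul_apply, smul_eq_mul]
  linarith

theorem sSeq_eventually_const {M : Type*} [AddCommMonoid M] {H : AddSubmonoid M}
    (hfg : H.FG) {a : M} (ha : a ∈ H) :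
    ∃ N : ℕ, 1 ≤ N ∧ ∀ n : ℕ, N ≤ n → sSeq H a n = sSeq H a N := by
  have hbdd : BddAbove (Set.range (sSeq H a)) := by
    refine ⟨{b | IsAtomOf H b}.ncard, ?_⟩
    rintro _ ⟨n, rfl⟩
    exact Set.ncard_le_ncard (fun b hb => hb.1) hfg.finite_atoms
  obtain ⟨N, hN⟩ := Nat.sSup_mem (Set.range_nonempty _) hbdd
  have hmax : ∀ n, sSeq H a n ≤ sSeq H a N := fun n => hN ▸ le_csSup hbdd ⟨n, rfl⟩
  have hmono := sSeq_monotone hfg ha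
  have hconst : ∀ n, N ≤ n → sSeq H a n = sSeq H a N :=
    fun n hn => (hmax n).antisymm (hmono hn)
  refine ⟨N + 1, N.succ_pos, fun n hn => ?_⟩
  rw [hconst n (by omega), hconst (N + 1) (by omega)]

theorem divisor_sequence_basic_properties {t : ℕ} (ht : 1 ≤ t)
    (H : AddSubmonoid (Fin t → ℕ)) (hfull : IsFull H) (hfg : H.FG)
    (a : Fin t → ℕ) (ha : IsAtomOf H a) :
    sSeq H a 1 = 1 ∧
    (∀ n : ℕ, 1 ≤ n → sSeq H a n ≠ 2) ∧
    (∀ n : ℕ, 1 ≤ n → sSeq H a n ≤ sSeq H a (n + 1)) ∧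
    (∃ N : ℕ, 1 ≤ N ∧ ∀ n : ℕ, N ≤ n → sSeq H a n = sSeq H a N) := by
  exact ⟨sSeq_one H ha, fun n hn => sSeq_ne_two hfull ha hn,
    fun n _ => sSeq_monotone hfg ha.1 n.le_succ, sSeq_eventually_const hfg ha.1⟩
end

section
/- Let t ≥ 1 and let H be a full, finitely generated additive submonoid of ℕ^t. Let x and y be atoms of H and let m, n be positive integers with m ≤ n − 1. If m•x divides n•y in H but m•x does not divide (n−1)•y in H, then (m+1)•x does not divide n•y in H. -/
theorem minimal_power_lemma {t : ℕ} (ht : 1 ≤ t)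
    (H : AddSubmonoid (Fin t → ℕ)) (hfull : IsFull H) (hfg : H.FG)
    (x y : Fin t → ℕ) (hx : IsAtomOf H x) (hy : IsAtomOf H y)
    (m n : ℕ) (hm : 1 ≤ m) (hn : 1 ≤ n) (hmn : m ≤ n - 1)
    (hdvd : DividesIn H (m • x) (n • y))
    (hndvd : ¬ DividesIn H (m • x) ((n - 1) • y)) :
    ¬ DividesIn H ((m + 1) • x) (n • y) := by
  rintro ⟨c, -, hc⟩
  obtain ⟨k, rfl⟩ : ∃ k, n = k + 1 := ⟨n - 1, by omega⟩
  simp only [Nat.add_sub_cancel] at hmn hndvd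
  have hnle : ¬ m • x ≤ k • y := fun hle =>
    hndvd ⟨k • y - m • x,
      hfull _ (H.nsmul_mem hx.1 m) _ (H.nsmul_mem hy.1 k) hle,
      (add_tsub_cancel_of_le hle).symm⟩
  refine hnle fun i => ?_
  by_contra! hlt
  have hi := congrFun hc i
  simp only [Pi.add_apply, Pi.smul_apply, smul_eq_mul] at hi hlt
  have hxy : x i ≤ y i := by linarith
  exact absurd hlt (Nat.mul_le_mul hmn hxy).not_gt
end

section
/- For all integers n ≥ 2 and k ≥ 2, there exist t ≥ 1, a finitely generated normal additive submonoid H of ℕ^t, and an atom a of H such that s_i(a) = 1 for all 1 ≤ i < k and s_i(a) = n + 1 for all i ≥ k. -/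
/-- The submonoid of `ι → ℕ` of vectors all of whose coordinates are congruent modulo `k`. -/
def congruentVectors (ι : Type*) (k : ℕ) : AddSubmonoid (ι → ℕ) where
  carrier := {x | ∀ i j, x i ≡ x j [MOD k]}
  zero_mem' := fun _ _ => rfl
  add_mem' := fun ha hb i j => (ha i j).add (hb i j)

namespace congruentVectors

variable {ι : Type*} {k : ℕ}

theorem one_mem : (1 : ι → ℕ) ∈ congruentVectors ι k := fun _ _ => rfl

theorem modEq_zero_single [DecidableEq ι] (j i : ι) :
    (Pi.single j k : ι → ℕ) i ≡ 0 [MOD k] := by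
  rcases eq_or_ne i j with rfl | h <;> simp [Nat.ModEq, *]

theorem single_mem [DecidableEq ι] (j : ι) :
    (Pi.single j k : ι → ℕ) ∈ congruentVectors ι k :=
  fun a b => (modEq_zero_single j a).trans (modEq_zero_single j b).symm

theorem single_le_iff [DecidableEq ι] {j : ι} {v : ι → ℕ} : Pi.single j k ≤ v ↔ k ≤ v j := by
  simp [Pi.single, update_le_iff]

theorem dividesIn_iff_le {u v : ι → ℕ} (hu : u ∈ congruentVectors ι k)
    (hv : v ∈ congruentVectors ι k) : DividesIn (congruentVectors ι k) u v ↔ u ≤ v := by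
  constructor
  · rintro ⟨c, -, rfl⟩
    exact le_self_add
  · intro h
    obtain ⟨c, rfl⟩ := exists_add_of_le h
    exact ⟨c, fun i j => Nat.ModEq.add_left_cancel (hu i j) (hv i j), rfl⟩

theorem eq_of_isAtomOf_of_le {u v : ι → ℕ} (hv : IsAtomOf (congruentVectors ι k) v)
    (hu : u ∈ congruentVectors ι k) (hu0 : u ≠ 0) (h : u ≤ v) : v = u := by
  obtain ⟨c, hc, rfl⟩ := (dividesIn_iff_le hu hv.1).2 h
  simp [(hv.2.2 u c hu hc rfl).resolve_left hu0]

theorem fg [Fintype ι] [Nonempty ι] : (congruentVectors ι k).FG := by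
  classical
  refine (AddSubmonoid.fg_iff _).2 ⟨insert 1 (Set.range fun j => Pi.single j k), ?_,
    (Set.finite_range _).insert _⟩
  refine le_antisymm (AddSubmonoid.closure_le.2 ?_) fun x hx => ?_
  · rintro _ (rfl | ⟨j, rfl⟩)
    exacts [one_mem, single_mem j]
  · obtain ⟨i₀⟩ := ‹Nonempty ι›
    have hdecomp : x = (x i₀ % k) • (1 : ι → ℕ) + ∑ j, (x j / k) • Pi.single j k := by
      funext i
      have hmod : x i % k = x i₀ % k := hx i i₀
      simp [Finset.sum_apply, Pi.single_apply, ← hmod, Nat.mod_add_div']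
    rw [hdecomp]
    exact add_mem (nsmul_mem (AddSubmonoid.subset_closure (Set.mem_insert _ _)) _)
      (sum_mem fun j _ => nsmul_mem
        (AddSubmonoid.subset_closure (Set.mem_insert_of_mem _ (Set.mem_range_self j))) _)

theorem isNormal : IsNormal (congruentVectors ι k) := by
  rintro g hg ⟨N, hN, y, -, hy⟩
  have hcongr : ∀ i j, g i ≡ g j [ZMOD k] := by
    clear hy
    induction hg using AddSubgroup.closure_induction with
    | mem _ hx =>
      obtain ⟨x, hx, rfl⟩ := hx
      exact fun i j => Int.natCast_modEq_iff.2 (hx i j)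
    | zero => exact fun _ _ => rfl
    | add _ _ _ _ ha hb => exact fun i j => (ha i j).add (hb i j)
    | neg _ _ ha => exact fun i j => (ha i j).neg
  have hnonneg : ∀ i, 0 ≤ g i := fun i => by
    have hyi : (y i : ℤ) = N * g i := by simpa [natIntMap] using congrFun hy i
    have hN' : (0 : ℤ) < N := by exact_mod_cast hN
    exact nonneg_of_mul_nonneg_right (hyi ▸ Int.natCast_nonneg _) hN'
  lift g to ι → ℕ using hnonneg
  exact ⟨g, fun i j => Int.natCast_modEq_iff.1 (hcongr i j), rfl⟩

theorem isAtomOf_one [Nonempty ι] (hk : 2 ≤ k) : IsAtomOf (congruentVectors ι k) 1 := by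
  refine ⟨one_mem, one_ne_zero, fun b c hb hc h => ?_⟩
  have hsum : ∀ i, 1 = b i + c i := congrFun h
  by_contra! hne
  obtain ⟨i, hi⟩ := Function.ne_iff.1 hne.1
  obtain ⟨j, hj⟩ := Function.ne_iff.1 hne.2
  have hmod := hb i j
  have hbi : b i = 1 := by have := hsum i; simp at hi; omega
  have hbj : b j = 0 := by have := hsum j; simp at hj; omega
  rw [hbi, hbj, Nat.modEq_zero_iff_dvd, Nat.dvd_one] at hmod
  omega

theorem isAtomOf_single [DecidableEq ι] [Nontrivial ι] (hk : k ≠ 0) (j : ι) :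
    IsAtomOf (congruentVectors ι k) (Pi.single j k) := by
  refine ⟨single_mem j, by simpa using hk, fun b c hb hc h => ?_⟩
  have hoff : ∀ i, i ≠ j → b i = 0 ∧ c i = 0 := fun i hi => by
    have := congrFun h i
    simp only [Pi.single_eq_of_ne hi, Pi.add_apply] at this
    omega
  have hsum : k = b j + c j := by simpa using congrFun h j
  obtain ⟨i, hi⟩ := exists_ne j
  have hdvd : k ∣ b j := by
    simpa [(hoff i hi).1, Nat.modEq_zero_iff_dvd] using hb j i
  rcases Nat.eq_zero_or_pos (b j) with hbj | hbj
  · left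
    funext l
    rcases eq_or_ne l j with rfl | hl
    exacts [hbj, (hoff l hl).1]
  · right
    have := Nat.le_of_dvd hbj hdvd
    funext l
    rcases eq_or_ne l j with rfl | hl
    exacts [show c l = 0 by omega, (hoff l hl).2]

theorem isAtomOf_iff [DecidableEq ι] [Nontrivial ι] (hk : 2 ≤ k) {b : ι → ℕ} :
    IsAtomOf (congruentVectors ι k) b ↔ b = 1 ∨ ∃ j, b = Pi.single j k := by
  constructor
  · intro hb
    by_cases hpos : ∀ i, 1 ≤ b i
    · exact Or.inl (eq_of_isAtomOf_of_le hb one_mem one_ne_zero hpos)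
    · push Not at hpos
      obtain ⟨i, hi⟩ := hpos
      obtain ⟨j, hj⟩ := Function.ne_iff.1 hb.2.1
      have hdvd : k ∣ b j := by
        simpa [Nat.lt_one_iff.1 hi, Nat.modEq_zero_iff_dvd] using hb.1 j i
      refine Or.inr ⟨j, eq_of_isAtomOf_of_le hb (single_mem j) (by simp; omega) ?_⟩
      exact single_le_iff.2 (Nat.le_of_dvd (Nat.pos_of_ne_zero hj) hdvd)
  · rintro (rfl | ⟨j, rfl⟩)
    exacts [isAtomOf_one hk, isAtomOf_single (by omega) j]

theorem setOf_isAtomOf_dividesIn_nsmul_one [DecidableEq ι] [Nontrivial ι] (hk : 2 ≤ k)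
    {m : ℕ} (hm : 1 ≤ m) :
    {b | IsAtomOf (congruentVectors ι k) b ∧ DividesIn (congruentVectors ι k) b (m • 1)} =
      insert 1 {b | k ≤ m ∧ ∃ j, b = Pi.single j k} := by
  have hmem : m • (1 : ι → ℕ) ∈ congruentVectors ι k := nsmul_mem one_mem m
  have hone : (1 : ι → ℕ) ≤ m • 1 := fun i => by simpa using hm
  ext b
  simp only [Set.mem_ofPred_eq, Set.mem_insert_iff, isAtomOf_iff hk, or_and_right]
  refine or_congr ?_ ?_
  · exact and_iff_left_of_imp fun h => h ▸ (dividesIn_iff_le one_mem hmem).2 hone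
  · rw [and_comm]
    refine and_congr_left ?_
    rintro ⟨j, rfl⟩
    rw [dividesIn_iff_le (single_mem j) hmem, single_le_iff]
    simp

theorem sSeq_one_of_lt [Nontrivial ι] {m : ℕ} (hm : 1 ≤ m) (hmk : m < k) :
    sSeq (congruentVectors ι k) 1 m = 1 := by
  classical
  rw [sSeq, setOf_isAtomOf_dividesIn_nsmul_one (by omega) hm]
  simp [hmk.not_ge]

theorem sSeq_one_of_le [Finite ι] [Nontrivial ι] (hk : 2 ≤ k) {m : ℕ} (hkm : k ≤ m) :
    sSeq (congruentVectors ι k) 1 m = Nat.card ι + 1 := by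
  classical
  have hrange : {b : ι → ℕ | k ≤ m ∧ ∃ j, b = Pi.single j k} =
      Set.range fun j => Pi.single j k := by
    ext b
    simp [hkm, eq_comm]
  have hnotMem : (1 : ι → ℕ) ∉ Set.range fun j : ι => (Pi.single j k : ι → ℕ) := by
    rintro ⟨j, hj⟩
    obtain ⟨i, hi⟩ := exists_ne j
    simpa [hi] using congrFun hj i
  have hinj : Function.Injective fun j : ι => (Pi.single j k : ι → ℕ) := fun i j h => by
    by_contra hij
    have := congrFun h i
    simp [hij] at this
    omega
  rw [sSeq, setOf_isAtomOf_dividesIn_nsmul_one hk (by omega), hrange,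
    Set.ncard_insert_of_notMem hnotMem (Set.finite_range _), Set.ncard_range_of_injective hinj]

end congruentVectors

theorem realization_one_jump {n k : ℕ} (hn : 2 ≤ n) (hk : 2 ≤ k) :
    ∃ (t : ℕ), 1 ≤ t ∧ ∃ H : AddSubmonoid (Fin t → ℕ), H.FG ∧ IsNormal H ∧
      ∃ a : Fin t → ℕ, IsAtomOf H a ∧
        (∀ i : ℕ, 1 ≤ i → i < k → sSeq H a i = 1) ∧
        (∀ i : ℕ, k ≤ i → sSeq H a i = n + 1) := by
  have : Nontrivial (Fin n) := Fin.nontrivial_iff_two_le.2 hn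
  refine ⟨n, by omega, congruentVectors (Fin n) k, congruentVectors.fg,
    congruentVectors.isNormal, 1, congruentVectors.isAtomOf_one hk,
    fun i hi hik => congruentVectors.sSeq_one_of_lt hi hik, fun i hki => ?_⟩
  rw [congruentVectors.sSeq_one_of_le hk hki, Nat.card_fin]
end

section
/- For every odd integer k ≥ 3 and every integer n ≥ 4, there exist t ≥ 1, a finitely generated normal additive submonoid H of ℕ^t, and an atom a of H such that s_1(a) = 1, s_i(a) = n for all 2 ≤ i < k, and s_i(a) = n + 1 for all i ≥ k. -/
/-- The submonoid of `ℕ^(m+1)` of all `f` with `2 * f i ≡ f 0` modulo `2 * d + 1` for `i ≠ 0`. -/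
def doublingMonoid (d m : ℕ) : AddSubmonoid (Fin (m + 1) → ℕ) where
  carrier := {f | ∀ i : Fin m, (2 * d + 1 : ℤ) ∣ 2 * (f i.succ : ℤ) - f 0}
  zero_mem' := by simp
  add_mem' := by
    intro f g hf hg i
    have h := dvd_add (hf i) (hg i)
    rwa [← add_sub_add_comm, ← mul_add, ← Nat.cast_add, ← Nat.cast_add] at h

namespace doublingMonoid

variable {d m : ℕ}

theorem isFull : IsFull (doublingMonoid d m) := by
  intro u hu v hv huv i
  obtain ⟨p, hp⟩ := hu i
  obtain ⟨q, hq⟩ := hv i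
  refine ⟨q - p, ?_⟩
  rw [Pi.sub_apply, Pi.sub_apply, Nat.cast_sub (huv _), Nat.cast_sub (huv _)]
  linear_combination hq - hp

theorem isNormal : IsNormal (doublingMonoid d m) := by
  intro g hg ⟨N, hN, f, hf, hfg⟩
  have hdvd : ∀ i : Fin m, (2 * d + 1 : ℤ) ∣ 2 * g i.succ - g 0 := by
    clear hfg
    induction hg using AddSubgroup.closure_induction with
    | mem x hx =>
      obtain ⟨u, hu, rfl⟩ := hx
      exact hu
    | zero => simp
    | add x y _ _ hx hy =>
      intro i
      obtain ⟨p, hp⟩ := hx i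
      obtain ⟨q, hq⟩ := hy i
      refine ⟨p + q, ?_⟩
      rw [Pi.add_apply, Pi.add_apply]
      linear_combination hp + hq
    | neg x _ hx =>
      intro i
      obtain ⟨p, hp⟩ := hx i
      refine ⟨-p, ?_⟩
      rw [Pi.neg_apply, Pi.neg_apply]
      linear_combination -hp
  have hnonneg : ∀ j, 0 ≤ g j := by
    intro j
    have h := congrFun hfg j
    simp only [natIntMap, Pi.smul_apply, nsmul_eq_mul] at h
    have hN' : (0 : ℤ) < N := by exact_mod_cast hN
    exact nonneg_of_mul_nonneg_right (h ▸ Int.natCast_nonneg _) hN'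
  have hcast : ∀ j, ((g j).toNat : ℤ) = g j := fun j => Int.toNat_of_nonneg (hnonneg j)
  refine ⟨fun j => (g j).toNat, fun i => ?_, funext hcast⟩
  simp only [hcast]
  exact hdvd i

theorem dividesIn_iff_le {b v : Fin (m + 1) → ℕ} (hb : b ∈ doublingMonoid d m)
    (hv : v ∈ doublingMonoid d m) : DividesIn (doublingMonoid d m) b v ↔ b ≤ v := by
  constructor
  · rintro ⟨c, -, rfl⟩
    exact le_self_add
  · intro h
    exact ⟨v - b, isFull b hb v hv h, (add_tsub_cancel_of_le h).symm⟩

variable (d m) in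
/-- The atom `(1, d + 1, …, d + 1)`. -/
def central : Fin (m + 1) → ℕ := Fin.cons 1 fun _ => d + 1

variable (m) in
/-- The atom `(2, 1, …, 1)`. -/
def low : Fin (m + 1) → ℕ := Fin.cons 2 fun _ => 1

variable (d m) in
/-- The atom `(2 * d + 1, 0, …, 0)`. -/
def tall : Fin (m + 1) → ℕ := Fin.cons (2 * d + 1) fun _ => 0

variable (d) in
/-- The atom with the entry `2 * d + 1` at `i.succ` and zeros elsewhere. -/
def axis (i : Fin m) : Fin (m + 1) → ℕ := Fin.cons 0 (Pi.single i (2 * d + 1))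

variable (d m) in
/-- The atoms of `doublingMonoid d m` other than `tall d m`. -/
def shortAtoms : Set (Fin (m + 1) → ℕ) :=
  insert (central d m) (insert (low m) (Set.range (axis d)))

variable (d m) in
/-- The set of atoms of `doublingMonoid d m`. -/
def atoms : Set (Fin (m + 1) → ℕ) :=
  insert (tall d m) (shortAtoms d m)

theorem atoms_subset : atoms d m ⊆ doublingMonoid d m := by
  rintro f (rfl | rfl | rfl | ⟨j, rfl⟩) i
  · exact ⟨-1, by simp only [tall, Fin.cons_succ, Fin.cons_zero]; push_cast; ring⟩
  · exact ⟨1, by simp only [central, Fin.cons_succ, Fin.cons_zero]; push_cast; ring⟩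
  · simp [low]
  · by_cases h : i = j
    · subst h
      simp [axis]
    · simp [axis, h]

theorem exists_atom_le (hm : 0 < m) {f : Fin (m + 1) → ℕ} (hf : f ∈ doublingMonoid d m)
    (hf0 : f ≠ 0) : ∃ g ∈ atoms d m, g ≤ f := by
  by_cases hbig : ∃ i : Fin m, 2 * d + 1 ≤ f i.succ
  · obtain ⟨i, hi⟩ := hbig
    refine ⟨axis d i, by simp [atoms, shortAtoms], ?_⟩
    rw [Pi.le_def, Fin.forall_fin_succ]
    refine ⟨by simp [axis], fun j => ?_⟩
    by_cases h : j = i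
    · subst h
      simpa [axis] using hi
    · simp [axis, h]
  push Not at hbig
  have hodd : IsCoprime (2 * d + 1 : ℤ) 2 := ⟨1, -d, by ring⟩
  have heq : ∀ i, f (Fin.succ i) = f (Fin.succ (⟨0, hm⟩ : Fin m)) := by
    intro i
    set j : Fin m := ⟨0, hm⟩
    have h := dvd_sub (hf i) (hf j)
    have h2 : (2 * d + 1 : ℤ) ∣ f i.succ - f j.succ := by
      apply hodd.dvd_of_dvd_mul_left
      convert h using 1
      ring
    have h3 := Int.eq_zero_of_abs_lt_dvd h2 (by
      have := hbig i
      have := hbig j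
      rw [abs_lt]
      omega)
    omega
  have hdvd := hf ⟨0, hm⟩
  have hlt := hbig ⟨0, hm⟩
  generalize f (Fin.succ (⟨0, hm⟩ : Fin m)) = x at *
  rcases Nat.eq_zero_or_pos x with rfl | hx
  · refine ⟨tall d m, by simp [atoms, shortAtoms], ?_⟩
    have h0 : f 0 ≠ 0 := by
      intro h0
      apply hf0
      funext j
      refine Fin.cases h0 (fun i => heq i) j
    have hle : 2 * d + 1 ≤ f 0 := by
      apply Nat.le_of_dvd (Nat.pos_of_ne_zero h0)
      have : (2 * d + 1 : ℤ) ∣ f 0 := by simpa using hdvd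
      exact_mod_cast this
    rw [Pi.le_def, Fin.forall_fin_succ]
    exact ⟨by simpa [tall] using hle, fun i => by simp [tall]⟩
  by_cases h2 : 2 ≤ f 0
  · refine ⟨low m, by simp [atoms, shortAtoms], ?_⟩
    rw [Pi.le_def, Fin.forall_fin_succ]
    exact ⟨by simpa [low] using h2, fun i => by simpa [low, heq i, Nat.one_le_iff_ne_zero] using hx.ne'⟩
  by_cases h0 : f 0 = 0
  · exfalso
    rw [h0, Nat.cast_zero, sub_zero] at hdvd
    have h3 := Int.le_of_dvd (by omega) (hodd.dvd_of_dvd_mul_left hdvd)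
    omega
  · refine ⟨central d m, by simp [atoms, shortAtoms], ?_⟩
    have h1 : f 0 = 1 := by omega
    rw [h1] at hdvd
    have h3 := Int.le_of_dvd (by omega) hdvd
    rw [Pi.le_def, Fin.forall_fin_succ]
    refine ⟨by simp [central, h1], fun i => ?_⟩
    simp only [central, Fin.cons_succ, heq i]
    push_cast at h3
    omega

theorem axis_le_iff {i : Fin m} {f : Fin (m + 1) → ℕ} :
    axis d i ≤ f ↔ 2 * d + 1 ≤ f i.succ := by
  rw [Pi.le_def, Fin.forall_fin_succ]
  constructor
  · rintro ⟨-, h⟩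
    simpa [axis] using h i
  · refine fun hi => ⟨by simp [axis], fun j => ?_⟩
    by_cases h : j = i
    · subst h
      simpa [axis] using hi
    · simp [axis, h]

theorem cons_const_le_iff {f : Fin (m + 1) → ℕ} {y x : ℕ} :
    (Fin.cons y (fun _ => x) : Fin (m + 1) → ℕ) ≤ f ↔ y ≤ f 0 ∧ ∀ i : Fin m, x ≤ f i.succ := by
  rw [Pi.le_def, Fin.forall_fin_succ]
  simp

theorem isAntichain_atoms (hd : 0 < d) (hm : 0 < m) :
    IsAntichain (· ≤ ·) (atoms d m) := by
  have : Nonempty (Fin m) := ⟨⟨0, hm⟩⟩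
  rintro f (rfl | rfl | rfl | ⟨i, rfl⟩) g (rfl | rfl | rfl | ⟨j, rfl⟩) hne hle <;>
    simp only [tall, central, low, cons_const_le_iff, axis_le_iff] at hle
  all_goals try exact hne rfl
  all_goals
    simp only [axis, Fin.cons_zero, Fin.cons_succ, forall_const] at hle
    try omega
  by_cases h : i = j
  · exact hne (congrArg _ h)
  · simp [h] at hle

theorem zero_notMem_atoms : (0 : Fin (m + 1) → ℕ) ∉ atoms d m := by
  rintro (h | h | h | ⟨i, h⟩)
  · simpa [tall] using congrFun h 0
  · simpa [central] using congrFun h 0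
  · simpa [low] using congrFun h 0
  · simpa [axis] using congrFun h i.succ

theorem isAtomOf_iff (hd : 0 < d) (hm : 0 < m) {f : Fin (m + 1) → ℕ} :
    IsAtomOf (doublingMonoid d m) f ↔ f ∈ atoms d m := by
  constructor
  · rintro ⟨hf, hf0, hirr⟩
    obtain ⟨g, hg, hgf⟩ := exists_atom_le hm hf hf0
    have hgH := atoms_subset hg
    rcases hirr g (f - g) hgH (isFull g hgH f hf hgf) (add_tsub_cancel_of_le hgf).symm with h | h
    · exact absurd (h ▸ hg) (zero_notMem_atoms)
    · rwa [le_antisymm (tsub_eq_zero_iff_le.mp h) hgf]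
  · intro hf
    refine ⟨atoms_subset hf, fun h => zero_notMem_atoms (h ▸ hf), ?_⟩
    rintro b c hb - rfl
    by_contra! h
    obtain ⟨g, hg, hgb⟩ := exists_atom_le hm hb h.1
    have heq := (isAntichain_atoms hd hm).eq hg hf (hgb.trans le_self_add)
    have hle : b + c ≤ b := heq ▸ hgb
    exact h.2 (by simpa using hle)

theorem fg : (doublingMonoid d m).FG := by
  apply AddSubmonoid.fg_of_subtractive
  intro x hx y hxy
  simpa using isFull x hx (x + y) hxy le_self_add

theorem sSeq_eq (hd : 0 < d) (hm : 0 < m) (i : ℕ) :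
    sSeq (doublingMonoid d m) (central d m) i = {b ∈ atoms d m | b ≤ i • central d m}.ncard := by
  have hc : central d m ∈ doublingMonoid d m := atoms_subset (by simp [atoms, shortAtoms])
  unfold sSeq
  congr 1
  ext b
  rw [Set.mem_ofPred_eq, isAtomOf_iff hd hm]
  exact and_congr_right fun hb =>
    dividesIn_iff_le (atoms_subset hb) (AddSubmonoid.nsmul_mem _ hc i)

theorem central_le_nsmul {i : ℕ} (hi : 1 ≤ i) : central d m ≤ i • central d m :=
  le_self_nsmul zero_le (by omega)

theorem low_le_nsmul {i : ℕ} (hi : 2 ≤ i) : low m ≤ i • central d m := by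
  refine cons_const_le_iff.mpr ⟨by simpa [central] using hi, fun j => ?_⟩
  simp only [central, Pi.smul_apply, Fin.cons_succ, smul_eq_mul]
  nlinarith

theorem axis_le_nsmul {i : ℕ} (hi : 2 ≤ i) (j : Fin m) : axis d j ≤ i • central d m := by
  refine axis_le_iff.mpr ?_
  simp only [central, Pi.smul_apply, Fin.cons_succ, smul_eq_mul]
  nlinarith

theorem tall_le_nsmul_iff {i : ℕ} : tall d m ≤ i • central d m ↔ 2 * d + 1 ≤ i := by
  simp [tall, cons_const_le_iff, central]

theorem axis_injective : Function.Injective (axis d (m := m)) := by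
  intro i j h
  by_contra hij
  simpa [axis, hij] using congrFun h i.succ

theorem finite_shortAtoms : (shortAtoms d m).Finite :=
  ((Set.finite_range _).insert _).insert _

theorem ncard_shortAtoms : (shortAtoms d m).ncard = m + 2 := by
  have hlow : low m ∉ Set.range (axis d) := by
    rintro ⟨i, h⟩
    simpa [low, axis] using congrFun h 0
  have hcentral : central d m ∉ insert (low m) (Set.range (axis d)) := by
    rintro (h | ⟨i, h⟩)
    · simpa [low, central] using congrFun h 0
    · simpa [central, axis] using congrFun h 0
  rw [shortAtoms, Set.ncard_insert_of_notMem hcentral ((Set.finite_range _).insert _),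
    Set.ncard_insert_of_notMem hlow (Set.finite_range _),
    Set.ncard_range_of_injective axis_injective, Nat.card_fin]

theorem tall_notMem_shortAtoms (hd : 0 < d) : tall d m ∉ shortAtoms d m := by
  rintro (h | h | ⟨i, h⟩)
  · have := congrFun h 0
    simp only [tall, central, Fin.cons_zero] at this
    omega
  · have := congrFun h 0
    simp only [tall, low, Fin.cons_zero] at this
    omega
  · simpa [tall, axis] using congrFun h 0

theorem le_nsmul_of_mem_shortAtoms {f : Fin (m + 1) → ℕ} (hf : f ∈ shortAtoms d m) {i : ℕ}
    (hi : 2 ≤ i) : f ≤ i • central d m := by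
  rcases hf with rfl | rfl | ⟨j, rfl⟩
  · exact central_le_nsmul (by omega)
  · exact low_le_nsmul hi
  · exact axis_le_nsmul hi j

theorem sSeq_one (hd : 0 < d) (hm : 0 < m) :
    sSeq (doublingMonoid d m) (central d m) 1 = 1 := by
  have hc : central d m ∈ atoms d m := by simp [atoms, shortAtoms]
  rw [sSeq_eq hd hm, Set.ncard_eq_one]
  refine ⟨central d m, Set.ext fun b => ⟨fun ⟨hb, hle⟩ => ?_, ?_⟩⟩
  · exact (isAntichain_atoms hd hm).eq hb hc (one_nsmul (central d m) ▸ hle)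
  · rintro rfl
    exact ⟨hc, (one_nsmul _).ge⟩

theorem sSeq_of_lt (hd : 0 < d) (hm : 0 < m) {i : ℕ} (hi : 2 ≤ i) (hik : i < 2 * d + 1) :
    sSeq (doublingMonoid d m) (central d m) i = m + 2 := by
  rw [sSeq_eq hd hm, ← ncard_shortAtoms]
  congr 1
  ext b
  constructor
  · rintro ⟨rfl | hb, hle⟩
    · have := tall_le_nsmul_iff.mp hle
      omega
    · exact hb
  · exact fun hb => ⟨Or.inr hb, le_nsmul_of_mem_shortAtoms hb hi⟩

theorem sSeq_of_le (hd : 0 < d) (hm : 0 < m) {i : ℕ} (hik : 2 * d + 1 ≤ i) :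
    sSeq (doublingMonoid d m) (central d m) i = m + 3 := by
  have hcard : (atoms d m).ncard = m + 3 := by
    rw [atoms, Set.ncard_insert_of_notMem (tall_notMem_shortAtoms hd) finite_shortAtoms,
      ncard_shortAtoms]
  rw [sSeq_eq hd hm, ← hcard]
  congr 1
  ext b
  refine ⟨And.left, fun hb => ⟨hb, ?_⟩⟩
  rcases hb with rfl | hb
  · exact tall_le_nsmul_iff.mpr hik
  · exact le_nsmul_of_mem_shortAtoms hb (by omega)

end doublingMonoid

theorem realization_jump_of_size_one {n k : ℕ} (hk_odd : Odd k) (hk : 3 ≤ k) (hn : 4 ≤ n) :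
    ∃ (t : ℕ), 1 ≤ t ∧ ∃ H : AddSubmonoid (Fin t → ℕ), H.FG ∧ IsNormal H ∧
      ∃ a : Fin t → ℕ, IsAtomOf H a ∧
        sSeq H a 1 = 1 ∧
        (∀ i : ℕ, 2 ≤ i → i < k → sSeq H a i = n) ∧
        (∀ i : ℕ, k ≤ i → sSeq H a i = n + 1) := by
  obtain ⟨d, rfl⟩ := hk_odd
  obtain ⟨m, rfl⟩ := Nat.exists_eq_add_of_le' (show 2 ≤ n by omega)
  have hd : 0 < d := by omega
  have hm : 0 < m := by omega
  open doublingMonoid in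
  exact ⟨m + 1, by omega, doublingMonoid d m, fg, isNormal, central d m,
    (isAtomOf_iff hd hm).mpr (by simp [atoms, shortAtoms]), sSeq_one hd hm,
    fun i hi hik => sSeq_of_lt hd hm hi hik, fun i hik => sSeq_of_le hd hm hik⟩
end

section
/- For every odd integer n ≥ 3, there exist t ≥ 1, a finitely generated normal additive submonoid H of ℕ^t, and an atom x of H such that s_1(x) = 1, s_i(x) = 3 for all 2 ≤ i ≤ n − 1, and s_i(x) = 4 for all i ≥ n. -/
/-- The submonoid of `ℕ²` of pairs `(q, m)` with `2 m ≡ q` modulo `n`. -/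
def congrMonoid (n : ℕ) : AddSubmonoid (Fin 2 → ℕ) where
  carrier := {v | (n : ℤ) ∣ 2 * (v 1 : ℤ) - v 0}
  zero_mem' := by simp
  add_mem' := by
    intro a b ha hb
    have h : (n : ℤ) ∣ (2 * (a 1 : ℤ) - a 0) + (2 * (b 1 : ℤ) - b 0) := dvd_add ha hb
    change (n : ℤ) ∣ 2 * ((a 1 + b 1 : ℕ) : ℤ) - ((a 0 + b 0 : ℕ) : ℤ)
    convert h using 1
    push_cast
    ring

lemma mem_congrMonoid {n : ℕ} {v : Fin 2 → ℕ} :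
    v ∈ congrMonoid n ↔ (n : ℤ) ∣ 2 * (v 1 : ℤ) - v 0 := Iff.rfl

lemma dividesIn_congrMonoid_iff {n : ℕ} {b v : Fin 2 → ℕ} (hb : b ∈ congrMonoid n)
    (hv : v ∈ congrMonoid n) :
    DividesIn (congrMonoid n) b v ↔ b 0 ≤ v 0 ∧ b 1 ≤ v 1 := by
  constructor
  · rintro ⟨c, -, rfl⟩
    simp
  · rintro ⟨h0, h1⟩
    refine ⟨v - b, ?_, ?_⟩
    · rw [mem_congrMonoid] at *
      rw [Pi.sub_apply, Pi.sub_apply, Nat.cast_sub h0, Nat.cast_sub h1]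
      have h := dvd_sub hv hb
      ring_nf at h ⊢
      exact h
    · ext i
      fin_cases i <;> simp <;> omega

lemma isNormal_congrMonoid (n : ℕ) : IsNormal (congrMonoid n) := by
  rintro g hg ⟨N, hN, w, -, hw⟩
  have hdvd : (n : ℤ) ∣ 2 * g 1 - g 0 := by
    clear hw
    induction hg using AddSubgroup.closure_induction with
    | mem x hx =>
      obtain ⟨v, hv, rfl⟩ := hx
      exact hv
    | zero => simp
    | add x y _ _ hx hy =>
      have h := dvd_add hx hy
      rw [Pi.add_apply, Pi.add_apply]
      ring_nf at h ⊢
      exact h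
    | neg x _ hx =>
      have h := dvd_neg.mpr hx
      rw [Pi.neg_apply, Pi.neg_apply]
      ring_nf at h ⊢
      exact h
  have hnonneg : ∀ i, 0 ≤ g i := by
    intro i
    have h := congrFun hw i
    simp only [natIntMap, Pi.smul_apply, nsmul_eq_mul] at h
    have hN' : (0 : ℤ) < N := by exact_mod_cast hN
    exact nonneg_of_mul_nonneg_right (h ▸ Int.natCast_nonneg _) hN'
  have hg_cast : natIntMap (fun i => (g i).toNat) = g := by
    ext i
    exact Int.toNat_of_nonneg (hnonneg i)
  refine ⟨fun i => (g i).toNat, ?_, hg_cast⟩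
  change (n : ℤ) ∣ 2 * ((g 1).toNat : ℤ) - ((g 0).toNat : ℤ)
  rwa [Int.toNat_of_nonneg (hnonneg 0), Int.toNat_of_nonneg (hnonneg 1)]

/-- The four atoms of `congrMonoid (2 * r + 1)`. -/
def congrAtoms (r : ℕ) : Set (Fin 2 → ℕ) :=
  {![1, r + 1], ![0, 2 * r + 1], ![2, 1], ![2 * r + 1, 0]}

lemma congrAtoms_subset (r : ℕ) : congrAtoms r ⊆ congrMonoid (2 * r + 1) := by
  rintro v (rfl | rfl | rfl | rfl) <;> simp only [SetLike.mem_coe, mem_congrMonoid] <;> simp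
  · exact ⟨1, by ring⟩
  · exact ⟨-1, by ring⟩

lemma eq_zero_of_apply {v : Fin 2 → ℕ} (h0 : v 0 = 0) (h1 : v 1 = 0) : v = 0 := by
  ext i
  fin_cases i <;> assumption

lemma exists_congrAtoms_le {r : ℕ} {v : Fin 2 → ℕ} (hv : v ∈ congrMonoid (2 * r + 1))
    (hv0 : v ≠ 0) : ∃ b ∈ congrAtoms r, b 0 ≤ v 0 ∧ b 1 ≤ v 1 := by
  rw [mem_congrMonoid] at hv
  by_cases h1 : 2 * r + 1 ≤ v 1
  · exact ⟨![0, 2 * r + 1], by simp [congrAtoms], by simpa using h1⟩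
  by_cases h0 : 2 * r + 1 ≤ v 0
  · exact ⟨![2 * r + 1, 0], by simp [congrAtoms], by simpa using h0⟩
  obtain ⟨c, hc⟩ := hv
  push_cast at hc
  have hc_lt : c < 2 := by
    by_contra! h
    nlinarith
  have hc_gt : -1 < c := by
    by_contra! h
    nlinarith
  interval_cases c
  · refine ⟨![2, 1], by simp [congrAtoms], ?_⟩
    have : v 1 ≠ 0 := fun h => hv0 (eq_zero_of_apply (by omega) h)
    simp only [Matrix.cons_val_zero, Matrix.cons_val_one]
    omega
  · refine ⟨![1, r + 1], by simp [congrAtoms], ?_⟩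
    simp only [Matrix.cons_val_zero, Matrix.cons_val_one]
    omega

lemma ne_zero_of_mem_congrAtoms {r : ℕ} {v : Fin 2 → ℕ} (hv : v ∈ congrAtoms r) : v ≠ 0 := by
  rintro rfl
  rcases hv with h | h | h | h <;> have h0 := congrFun h 0 <;> have h1 := congrFun h 1 <;>
    simp at h0 h1

lemma closure_congrAtoms (r : ℕ) :
    AddSubmonoid.closure (congrAtoms r) = congrMonoid (2 * r + 1) := by
  refine le_antisymm (AddSubmonoid.closure_le.mpr (congrAtoms_subset r)) ?_
  suffices h : ∀ s : ℕ, ∀ v ∈ congrMonoid (2 * r + 1), v 0 + v 1 = s →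
      v ∈ AddSubmonoid.closure (congrAtoms r) from fun v hv => h _ v hv rfl
  intro s
  induction s using Nat.strong_induction_on with
  | _ s ih =>
    intro v hv hs
    by_cases hv0 : v = 0
    · exact hv0 ▸ zero_mem _
    obtain ⟨b, hb, hle⟩ := exists_congrAtoms_le hv hv0
    obtain ⟨c, hc, rfl⟩ := (dividesIn_congrMonoid_iff (congrAtoms_subset r hb) hv).mpr hle
    refine add_mem (AddSubmonoid.subset_closure hb) (ih (c 0 + c 1) ?_ c hc rfl)
    have hb0 : ¬(b 0 = 0 ∧ b 1 = 0) :=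
      fun h => ne_zero_of_mem_congrAtoms hb (eq_zero_of_apply h.1 h.2)
    simp only [Pi.add_apply] at hs
    omega

/-- An element of `congrMonoid (2 * r + 1)` with one coordinate zero and the other smaller than
`2 * r + 1` is zero. -/
lemma eq_zero_of_mem_congrMonoid {r : ℕ} {v : Fin 2 → ℕ} (hv : v ∈ congrMonoid (2 * r + 1))
    (h : v 0 = 0 ∧ v 1 < 2 * r + 1 ∨ v 1 = 0 ∧ v 0 < 2 * r + 1) : v = 0 := by
  by_contra hv0
  have h00 : ¬(v 0 = 0 ∧ v 1 = 0) := fun h => hv0 (eq_zero_of_apply h.1 h.2)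
  obtain ⟨b, hb, hle⟩ := exists_congrAtoms_le hv hv0
  rcases hb with rfl | rfl | rfl | rfl <;>
    simp only [Matrix.cons_val_zero, Matrix.cons_val_one] at hle <;> omega

lemma isAtomOf_congrMonoid_iff {r : ℕ} (hr : 1 ≤ r) {a : Fin 2 → ℕ} :
    IsAtomOf (congrMonoid (2 * r + 1)) a ↔ a ∈ congrAtoms r := by
  constructor
  · rintro ⟨ha, ha0, h⟩
    obtain ⟨b, hb, hle⟩ := exists_congrAtoms_le ha ha0
    have hb' := congrAtoms_subset r hb
    obtain ⟨c, hc, hbc⟩ := (dividesIn_congrMonoid_iff hb' ha).mpr hle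
    rcases h b c hb' hc hbc with h | rfl
    · exact absurd h (ne_zero_of_mem_congrAtoms hb)
    · rwa [hbc, add_zero]
  · intro ha
    refine ⟨congrAtoms_subset r ha, ne_zero_of_mem_congrAtoms ha, fun b c hb hc h => ?_⟩
    by_contra! hbc
    have hb' := mt (eq_zero_of_mem_congrMonoid hb) hbc.1
    have hc' := mt (eq_zero_of_mem_congrMonoid hc) hbc.2
    have hb0 : ¬(b 0 = 0 ∧ b 1 = 0) := fun h => hbc.1 (eq_zero_of_apply h.1 h.2)
    have hc0 : ¬(c 0 = 0 ∧ c 1 = 0) := fun h => hbc.2 (eq_zero_of_apply h.1 h.2)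
    have h0 := congrFun h 0
    have h1 := congrFun h 1
    rcases ha with rfl | rfl | rfl | rfl <;>
      simp only [Matrix.cons_val_zero, Matrix.cons_val_one, Pi.add_apply] at h0 h1 <;> omega

lemma setOf_isAtomOf_dividesIn_nsmul {r : ℕ} (hr : 1 ≤ r) (i : ℕ) :
    {b | IsAtomOf (congrMonoid (2 * r + 1)) b ∧
      DividesIn (congrMonoid (2 * r + 1)) b (i • ![1, r + 1])} =
    {b ∈ congrAtoms r | b 0 ≤ i ∧ b 1 ≤ i * (r + 1)} := by
  ext b
  simp only [Set.mem_ofPred_eq, isAtomOf_congrMonoid_iff hr]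
  refine and_congr_right fun hb => ?_
  rw [dividesIn_congrMonoid_iff (congrAtoms_subset r hb)
    (nsmul_mem (congrAtoms_subset r (by simp [congrAtoms])) i)]
  simp

theorem realization_one_three_four {n : ℕ} (hn_odd : Odd n) (hn : 3 ≤ n) :
    ∃ (t : ℕ), 1 ≤ t ∧ ∃ H : AddSubmonoid (Fin t → ℕ), H.FG ∧ IsNormal H ∧
      ∃ x : Fin t → ℕ, IsAtomOf H x ∧
        sSeq H x 1 = 1 ∧
        (∀ i : ℕ, 2 ≤ i → i ≤ n - 1 → sSeq H x i = 3) ∧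
        (∀ i : ℕ, n ≤ i → sSeq H x i = 4) := by
  obtain ⟨r, rfl⟩ := hn_odd
  have hr : 1 ≤ r := by omega
  refine ⟨2, one_le_two, congrMonoid (2 * r + 1), ?_, isNormal_congrMonoid _, ![1, r + 1],
    (isAtomOf_congrMonoid_iff hr).mpr (by simp [congrAtoms]), ?_, ?_, ?_⟩
  · rw [← closure_congrAtoms, AddSubmonoid.fg_iff]
    exact ⟨_, rfl, by simp [congrAtoms]⟩
  · rw [sSeq, setOf_isAtomOf_dividesIn_nsmul hr, Set.ncard_eq_one]
    refine ⟨![1, r + 1], Set.Subset.antisymm ?_ (by simp [congrAtoms])⟩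
    rintro b ⟨rfl | rfl | rfl | rfl, h⟩ <;>
      simp only [Matrix.cons_val_zero, Matrix.cons_val_one, Set.mem_singleton_iff] at h ⊢ <;> omega
  · intro i hi hin
    rw [sSeq, setOf_isAtomOf_dividesIn_nsmul hr, Set.ncard_eq_three]
    have hir : 2 * (r + 1) ≤ i * (r + 1) := Nat.mul_le_mul_right _ hi
    refine ⟨![1, r + 1], ![0, 2 * r + 1], ![2, 1], by simp, by simp, by simp,
      Set.Subset.antisymm ?_ ?_⟩
    · rintro b ⟨rfl | rfl | rfl | rfl, h⟩
      · simp
      · simp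
      · simp
      · simp only [Matrix.cons_val_zero, Matrix.cons_val_one] at h
        omega
    · rintro b (rfl | rfl | rfl) <;> refine ⟨by simp [congrAtoms], ?_⟩ <;>
        simp only [Matrix.cons_val_zero, Matrix.cons_val_one] <;> omega
  · intro i hi
    rw [sSeq, setOf_isAtomOf_dividesIn_nsmul hr]
    have hir : (2 * r + 1) * (r + 1) ≤ i * (r + 1) := Nat.mul_le_mul_right _ hi
    have hrr : 2 * r + 1 ≤ (2 * r + 1) * (r + 1) := Nat.le_mul_of_pos_right _ r.succ_pos
    have hrr' : r + 1 ≤ (2 * r + 1) * (r + 1) := Nat.le_mul_of_pos_left _ (by omega)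
    rw [Set.sep_eq_self_iff_mem_true.mpr, congrAtoms, Set.ncard_insert_of_notMem,
      Set.ncard_eq_three.mpr ⟨_, _, _, _, _, _, rfl⟩]
    · simp
    · simp
    · simp
    · simp
    · rintro b (rfl | rfl | rfl | rfl) <;>
        simp only [Matrix.cons_val_zero, Matrix.cons_val_one] <;> omega
end

section
/- Let t ≥ 1, let H be a full, finitely generated additive submonoid of ℕ^t, let x be an atom of H, and let n ≥ 3 be an integer such that s_1(x) = 1, s_i(x) = 3 for all 2 ≤ i ≤ n − 1, and s_n(x) = 4. Then n is odd. -/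
section AtomsOfFullSubmonoids

variable {ι : Type*} {H : AddSubmonoid (ι → ℕ)}

theorem IsFull.dividesIn_iff_le (hfull : IsFull H) {b v : ι → ℕ} (hb : b ∈ H) (hv : v ∈ H) :
    DividesIn H b v ↔ b ≤ v := by
  constructor
  · rintro ⟨c, -, rfl⟩
    exact le_self_add
  · intro h
    exact ⟨v - b, hfull b hb v hv h, (add_tsub_cancel_of_le h).symm⟩

/-- Distinct atoms of a full submonoid are incomparable. -/
theorem IsAtomOf.eq_of_le (hfull : IsFull H) {a b : ι → ℕ} (hb : IsAtomOf H b) (ha : a ∈ H)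
    (ha0 : a ≠ 0) (h : a ≤ b) : a = b := by
  have hsum : b = a + (b - a) := (add_tsub_cancel_of_le h).symm
  rcases hb.2.2 a (b - a) ha (hfull a ha b hb.1 h) hsum with h0 | h0
  · exact absurd h0 ha0
  · rw [h0, add_zero] at hsum
    exact hsum.symm

theorem IsAtomOf.ne_two_nsmul {a g : ι → ℕ} (ha : IsAtomOf H a) (hg : g ∈ H) : a ≠ 2 • g := by
  intro h
  have hg0 : g = 0 := by simpa using ha.2.2 g g hg hg (by rw [h, two_nsmul])
  exact ha.2.1 (by rw [h, hg0, smul_zero])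

/-- If `p = 2 • a - 2 • b` in a full submonoid, then `p` is twice an element of it. -/
theorem IsFull.exists_half (hfull : IsFull H) {a b p : ι → ℕ} (ha : a ∈ H) (hb : b ∈ H)
    (h : 2 • a = p + 2 • b) : ∃ g ∈ H, p = 2 • g ∧ a = g + b := by
  have hpt : ∀ j, 2 * a j = p j + 2 * b j := fun j => by simpa using congrFun h j
  have hle : b ≤ a := Pi.le_def.2 fun j => by have := hpt j; omega
  refine ⟨a - b, hfull b hb a ha hle, ?_, (tsub_add_cancel_of_le hle).symm⟩
  funext j
  have := hpt j
  simp only [Pi.smul_apply, Pi.sub_apply, smul_eq_mul]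
  omega

theorem exists_isAtomOf_le [Finite ι] (v : ι → ℕ) (hv : v ∈ H) (hv0 : v ≠ 0) :
    ∃ e, IsAtomOf H e ∧ e ≤ v := by
  induction v using WellFoundedLT.induction with
  | ind v ih =>
    by_cases hat : IsAtomOf H v
    · exact ⟨v, hat, le_rfl⟩
    · have : ∃ b c, b ∈ H ∧ c ∈ H ∧ v = b + c ∧ b ≠ 0 ∧ c ≠ 0 := by
        by_contra hcon
        push Not at hcon
        exact hat ⟨hv, hv0, fun b c hb hc h => or_iff_not_imp_left.2 (hcon b c hb hc h)⟩
      obtain ⟨b, c, hb, hc, rfl, hb0, hc0⟩ := this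
      have hlt : b < b + c := lt_add_of_pos_right b (pos_iff_ne_zero.2 hc0)
      obtain ⟨e, he, hle⟩ := ih b hlt hb hb0
      exact ⟨e, he, hle.trans hlt.le⟩

theorem exists_eq_nsmul_add_of_atoms [Finite ι] (hfull : IsFull H) {p q r : ι → ℕ} (v : ι → ℕ)
    (hv : v ∈ H) (hat : ∀ e, IsAtomOf H e → e ≤ v → e = p ∨ e = q ∨ e = r) :
    ∃ a b c : ℕ, v = a • p + b • q + c • r := by
  induction v using WellFoundedLT.induction with
  | ind v ih =>
    by_cases hv0 : v = 0
    · exact ⟨0, 0, 0, by simp [hv0]⟩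
    obtain ⟨e, he, hle⟩ := exists_isAtomOf_le v hv hv0
    have hsum : v = (v - e) + e := (tsub_add_cancel_of_le hle).symm
    have hlt : v - e < v := by
      conv_rhs => rw [hsum]
      exact lt_add_of_pos_right _ (pos_iff_ne_zero.2 he.2.1)
    obtain ⟨a, b, c, habc⟩ := ih (v - e) hlt (hfull e he.1 v hv hle)
      (fun f hf hfle => hat f hf (hfle.trans hlt.le))
    rw [hsum, habc]
    rcases hat e he hle with rfl | rfl | rfl
    · exact ⟨a + 1, b, c, by rw [add_nsmul, one_nsmul]; abel⟩
    · exact ⟨a, b + 1, c, by rw [add_nsmul, one_nsmul]; abel⟩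
    · exact ⟨a, b, c + 1, by rw [add_nsmul, one_nsmul]; abel⟩

/-- If only the atoms `x, y, z` divide `2 • x`, then `2 • x = y + z`. -/
theorem add_eq_two_nsmul_of_atoms [Finite ι] (hfull : IsFull H) {x y z : ι → ℕ}
    (hx : IsAtomOf H x) (hy : IsAtomOf H y) (hz : IsAtomOf H z) (hxy : y ≠ x)
    (hle : y ≤ 2 • x) (hat : ∀ e, IsAtomOf H e → e ≤ 2 • x → e = x ∨ e = y ∨ e = z) :
    y + z = 2 • x := by
  have hlept : ∀ j, y j ≤ 2 * x j := fun j => by simpa using hle j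
  have hyx : ¬ y ≤ x := fun h => hxy (hx.eq_of_le hfull hy.1 hy.2.1 h)
  obtain ⟨a, b, c, habc⟩ := exists_eq_nsmul_add_of_atoms hfull (2 • x - y)
    (hfull y hy.1 _ (H.nsmul_mem hx.1 2) hle)
    (fun e he h => hat e he (h.trans tsub_le_self))
  have hpt : ∀ j, 2 * x j = a * x j + (b + 1) * y j + c * z j := fun j => by
    have h := congrFun habc j
    simp only [Pi.smul_apply, Pi.sub_apply, Pi.add_apply, smul_eq_mul] at h
    have := hlept j
    rw [add_mul]
    omega
  obtain rfl : a = 0 := by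
    rcases a with _ | a
    · rfl
    · refine absurd (Pi.le_def.2 fun j => ?_) hyx
      have := hpt j
      nlinarith [Nat.zero_le (a * x j), Nat.zero_le (b * y j), Nat.zero_le (c * z j)]
  have hdiv : ∀ s t : ℕ, s • y + t • z ∈ H := fun s t =>
    H.add_mem (H.nsmul_mem hy.1 s) (H.nsmul_mem hz.1 t)
  rcases Nat.even_or_odd' b with ⟨b, rfl | rfl⟩ <;> rcases Nat.even_or_odd' c with ⟨c, rfl | rfl⟩
  · obtain ⟨g, hg, hyg, -⟩ := hfull.exists_half (p := y) hx.1 (hdiv b c) (by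
      funext j
      simp only [Pi.smul_apply, Pi.add_apply, smul_eq_mul]
      linarith [hpt j])
    exact absurd hyg (hy.ne_two_nsmul hg)
  · obtain ⟨g, hg, hyg, hxg⟩ := hfull.exists_half (p := y + z) hx.1 (hdiv b c) (by
      funext j
      simp only [Pi.smul_apply, Pi.add_apply, smul_eq_mul]
      linarith [hpt j])
    have hg0 : g ≠ 0 := by
      rintro rfl
      rw [smul_zero, add_eq_zero] at hyg
      exact hy.2.1 hyg.1
    rw [hyg, hx.eq_of_le hfull hg hg0 (hxg ▸ le_self_add)]
  · refine absurd (Pi.le_def.2 fun j => ?_) hyx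
    nlinarith [hpt j, Nat.zero_le (b * y j), Nat.zero_le (c * z j)]
  · obtain ⟨g, hg, hzg, -⟩ := hfull.exists_half (p := z) hx.1 (hdiv (b + 1) c) (by
      funext j
      simp only [Pi.smul_apply, Pi.add_apply, smul_eq_mul]
      linarith [hpt j])
    exact absurd hzg (hz.ne_two_nsmul hg)

/-- Suppose `y + z = 2 • x` and only the atoms `x, y, z` divide `(2 * m - 1) • x`. Then no
multiple of an atom `w` that does not divide `(2 * m - 1) • x` complements a multiple of `y` to
`(2 * m) • x`. -/
theorem two_mul_nsmul_ne_nsmul_add_nsmul [Finite ι] (hfull : IsFull H) {x y z w : ι → ℕ}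
    (hx : IsAtomOf H x) (hy : IsAtomOf H y) (hz : IsAtomOf H z) (hw : IsAtomOf H w)
    (hyz : y ≠ z) (hsum : y + z = 2 • x) {m : ℕ} (hm : 2 ≤ m)
    (hat : ∀ e, IsAtomOf H e → e ≤ (2 * m - 1) • x → e = x ∨ e = y ∨ e = z)
    (hwy : w ≠ y) (hwz : w ≠ z) (hwle : ¬ w ≤ (2 * m - 1) • x) {k a : ℕ} (hk : 1 ≤ k) :
    (2 * m) • x ≠ k • w + a • y := by
  intro h
  have nle : ∀ {p q : ι → ℕ}, IsAtomOf H p → IsAtomOf H q → p ≠ q → ¬ p ≤ q :=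
    fun hp hq hne hle => hne (hq.eq_of_le hfull hp.1 hp.2.1 hle)
  have hpt : ∀ j, 2 * m * x j = k * w j + a * y j := fun j => by simpa using congrFun h j
  have hspt : ∀ j, y j + z j = 2 * x j := fun j => by simpa using congrFun hsum j
  have hmono : ∀ {s : ℕ}, s ≤ 2 * m - 1 → s • x ≤ (2 * m - 1) • x := fun hs =>
    nsmul_le_nsmul_left zero_le hs
  have hmem : ∀ s t : ℕ, s • w + t • y ∈ H := fun s t =>
    H.add_mem (H.nsmul_mem hw.1 s) (H.nsmul_mem hy.1 t)
  have hmx : m • x ∈ H := H.nsmul_mem hx.1 m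
  rcases Nat.even_or_odd' k with ⟨k, rfl | rfl⟩ <;> rcases Nat.even_or_odd' a with ⟨a, rfl | rfl⟩
  · refine hwle (le_trans (fun j => ?_) (hmono (show m ≤ 2 * m - 1 by omega)))
    obtain ⟨k, rfl⟩ : ∃ l, k = l + 1 := ⟨k - 1, by omega⟩
    simp only [Pi.smul_apply, smul_eq_mul]
    nlinarith [hpt j, Nat.zero_le (k * w j), Nat.zero_le (a * y j)]
  · obtain ⟨g, hg, hyg, -⟩ := hfull.exists_half (p := y) hmx (hmem k a) (by
      funext j
      simp only [Pi.smul_apply, Pi.add_apply, smul_eq_mul]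
      linarith [hpt j])
    exact hy.ne_two_nsmul hg hyg
  · obtain ⟨g, hg, hwg, -⟩ := hfull.exists_half (p := w) hmx (hmem k a) (by
      funext j
      simp only [Pi.smul_apply, Pi.add_apply, smul_eq_mul]
      linarith [hpt j])
    exact hw.ne_two_nsmul hg hwg
  · obtain ⟨v, hv, hwv, hmv⟩ := hfull.exists_half (p := w + y) hmx (hmem k a) (by
      funext j
      simp only [Pi.smul_apply, Pi.add_apply, smul_eq_mul]
      linarith [hpt j])
    have hwvpt : ∀ j, w j + y j = 2 * v j := fun j => by simpa using congrFun hwv j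
    have hvm : v ≤ m • x := hmv ▸ le_self_add
    obtain ⟨c₁, c₂, c₃, hc⟩ := exists_eq_nsmul_add_of_atoms (p := z) (q := z) (r := z) hfull v hv
      (by
        intro e he hev
        rcases hat e he (hev.trans (hvm.trans (hmono (by omega)))) with rfl | rfl | rfl
        · refine absurd (Pi.le_def.2 fun j => ?_) (nle hz hw hwz.symm)
          have := Pi.le_def.1 hev j; have := hwvpt j; have := hspt j
          omega
        · refine absurd (Pi.le_def.2 fun j => ?_) (nle he hw hwy.symm)
          have := Pi.le_def.1 hev j; have := hwvpt j
          omega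
        · simp)
    obtain ⟨c, rfl⟩ : ∃ c : ℕ, v = c • z := ⟨c₁ + c₂ + c₃, by rw [hc, add_nsmul, add_nsmul]⟩
    have hwcpt : ∀ j, w j + y j = 2 * (c * z j) := fun j => by simpa using hwvpt j
    obtain ⟨u, hu, hwu, hcu⟩ := hfull.exists_half (p := w + z) (H.add_mem hv hx.1) hy.1 (by
      funext j
      simp only [Pi.smul_apply, Pi.add_apply, smul_eq_mul]
      linarith [hspt j, hwcpt j])
    have hwupt : ∀ j, w j + z j = 2 * u j := fun j => by simpa using congrFun hwu j
    have hum : u ≤ (m + 1) • x := by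
      rw [add_nsmul, one_nsmul]
      exact le_trans (hcu ▸ le_self_add) (add_le_add_left hvm x)
    obtain ⟨d₁, d₂, d₃, hd⟩ := exists_eq_nsmul_add_of_atoms (p := y) (q := y) (r := y) hfull u hu
      (by
        intro e he heu
        rcases hat e he (heu.trans (hum.trans (hmono (by omega)))) with rfl | rfl | rfl
        · refine absurd (Pi.le_def.2 fun j => ?_) (nle hy hw hwy.symm)
          have := Pi.le_def.1 heu j; have := hwupt j; have := hspt j
          omega
        · simp
        · refine absurd (Pi.le_def.2 fun j => ?_) (nle he hw hwz.symm)
          have := Pi.le_def.1 heu j; have := hwupt j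
          omega)
    obtain ⟨d, rfl⟩ : ∃ d : ℕ, u = d • y := ⟨d₁ + d₂ + d₃, by rw [hd, add_nsmul, add_nsmul]⟩
    have hprop : ∀ j, (2 * c + 1) * z j = (2 * d + 1) * y j := fun j => by
      have h₁ := hwcpt j
      have h₂ := hwupt j
      simp only [Pi.smul_apply, smul_eq_mul] at h₂
      linarith
    rcases le_total c d with hcd | hcd
    · refine nle hy hz hyz fun j => ?_
      refine le_of_mul_le_mul_left ?_ (show 0 < 2 * d + 1 by omega)
      rw [← hprop j]
      exact Nat.mul_le_mul_right _ (by omega)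
    · refine nle hz hy hyz.symm fun j => ?_
      refine le_of_mul_le_mul_left ?_ (show 0 < 2 * c + 1 by omega)
      rw [hprop j]
      exact Nat.mul_le_mul_right _ (by omega)

end AtomsOfFullSubmonoids

theorem one_three_four_implies_odd {t : ℕ} (ht : 1 ≤ t)
    (H : AddSubmonoid (Fin t → ℕ)) (hfull : IsFull H) (hfg : H.FG)
    (x : Fin t → ℕ) (hx : IsAtomOf H x) (n : ℕ) (hn : 3 ≤ n)
    (h1 : sSeq H x 1 = 1)
    (h3 : ∀ i : ℕ, 2 ≤ i → i ≤ n - 1 → sSeq H x i = 3)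
    (h4 : sSeq H x n = 4) :
    Odd n := by
  by_contra hodd
  obtain ⟨m, rfl⟩ := (Nat.not_odd_iff_even.1 hodd).two_dvd
  have hm : 2 ≤ m := by omega
  let D : ℕ → Set (Fin t → ℕ) := fun i => {e | IsAtomOf H e ∧ e ≤ i • x}
  have hD : ∀ i, sSeq H x i = (D i).ncard := fun i => by
    unfold sSeq
    congr 1
    ext e
    exact and_congr_right fun he => hfull.dividesIn_iff_le he.1 (H.nsmul_mem hx.1 i)
  have hfin : ∀ i, (D i).Finite := fun i =>
    (Set.finite_Iic (i • x)).subset fun e he => he.2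
  have hmono : ∀ {i j : ℕ}, i ≤ j → D i ⊆ D j := fun hij e he =>
    ⟨he.1, he.2.trans (nsmul_le_nsmul_left zero_le hij)⟩
  have hx2 : x ∈ D 2 := ⟨hx, by rw [two_nsmul]; exact le_self_add⟩
  obtain ⟨y, z, hyx, hzx, hyz, hD2⟩ :
      ∃ y z, y ≠ x ∧ z ≠ x ∧ y ≠ z ∧ D 2 = {x, y, z} := by
    have hcard : (D 2 \ {x}).ncard = 2 := by
      rw [Set.ncard_sdiff_singleton_of_mem hx2, ← hD, h3 2 le_rfl (by omega)]
    obtain ⟨y, z, hyz, hyz'⟩ := Set.ncard_eq_two.1 hcard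
    have hy : y ∈ D 2 \ {x} := by simp [hyz']
    have hz : z ∈ D 2 \ {x} := by simp [hyz']
    refine ⟨y, z, hy.2, hz.2, hyz, ?_⟩
    rw [← hyz', Set.insert_sdiff_singleton, Set.insert_eq_of_mem hx2]
  have hDm : D (2 * m - 1) = {x, y, z} := by
    rw [← hD2]
    refine (Set.eq_of_subset_of_ncard_le (hmono (by omega)) ?_ (hfin _)).symm
    rw [← hD, ← hD, h3 _ le_rfl (by omega), h3 _ (by omega) le_rfl]
  have hcard3 : (D (2 * m - 1)).ncard = 3 := by rw [← hD, h3 _ (by omega) le_rfl]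
  have hcard4 : (D (2 * m)).ncard = 4 := by rw [← hD, h4]
  obtain ⟨w, hw, hwD⟩ := Set.exists_mem_notMem_of_ncard_lt_ncard
    (s := D (2 * m - 1)) (t := D (2 * m)) (by omega) (hfin _)
  have hDn : insert w (D (2 * m - 1)) = D (2 * m) := by
    refine Set.eq_of_subset_of_ncard_le (Set.insert_subset hw (hmono (by omega))) ?_ (hfin _)
    rw [Set.ncard_insert_of_notMem hwD (hfin _), hcard3, hcard4]
  have hy2 : y ∈ D 2 := by simp [hD2]
  have hz2 : z ∈ D 2 := by simp [hD2]
  have hwle : ¬ w ≤ (2 * m - 1) • x := fun h => hwD ⟨hw.1, h⟩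
  have hwy : w ≠ y := fun h => hwD (h ▸ hmono (by omega) hy2)
  have hwz : w ≠ z := fun h => hwD (h ▸ hmono (by omega) hz2)
  have hat2 : ∀ e, IsAtomOf H e → e ≤ 2 • x → e = x ∨ e = y ∨ e = z := fun e he h => by
    have : e ∈ D 2 := ⟨he, h⟩
    simpa [hD2] using this
  have hatm : ∀ e, IsAtomOf H e → e ≤ (2 * m - 1) • x → e = x ∨ e = y ∨ e = z :=
    fun e he h => by
      have : e ∈ D (2 * m - 1) := ⟨he, h⟩
      simpa [hDm] using this
  have hsum := add_eq_two_nsmul_of_atoms hfull hx hy2.1 hz2.1 hyx hy2.2 hat2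
  have hsplit : ∀ j, (2 * m) * x j = (2 * m - 1) * x j + x j := fun j => by
    rw [← Nat.succ_mul]
    congr 1
    omega
  have hwx : ¬ w + x ≤ (2 * m) • x := fun h => hwle fun j => by
    have := h j
    have := hsplit j
    simp only [Pi.smul_apply, Pi.add_apply, smul_eq_mul] at *
    omega
  have hwn : w + ((2 * m) • x - w) = (2 * m) • x := add_tsub_cancel_of_le hw.2
  obtain ⟨k, a, b, hkab⟩ := exists_eq_nsmul_add_of_atoms (p := w) (q := y) (r := z) hfull
    ((2 * m) • x - w) (hfull w hw.1.1 _ (H.nsmul_mem hx.1 _) hw.2) (by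
      intro e he hle
      have hmem : e ∈ insert w (D (2 * m - 1)) :=
        hDn ▸ ⟨he, hle.trans tsub_le_self⟩
      rw [hDm] at hmem
      rcases hmem with h | rfl | h | h
      · exact Or.inl h
      · exact absurd (hwn ▸ add_le_add_right hle w) hwx
      · exact Or.inr (Or.inl h)
      · exact Or.inr (Or.inr h))
  rw [hkab] at hwn
  have hne := two_mul_nsmul_ne_nsmul_add_nsmul (a := a) (k := k + 1) hfull hx hy2.1 hz2.1 hw.1
    hyz hsum hm hatm hwy hwz hwle (by omega)
  have hne' := two_mul_nsmul_ne_nsmul_add_nsmul (a := b) (k := k + 1) hfull hx hz2.1 hy2.1 hw.1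
    hyz.symm (by rw [add_comm, hsum]) hm (fun e he h => (hatm e he h).imp_right Or.symm)
    hwz hwy hwle (by omega)
  rcases b with _ | b
  · exact hne (by rw [← hwn, add_nsmul, one_nsmul, zero_nsmul]; abel)
  rcases a with _ | a
  · exact hne' (by rw [← hwn, add_nsmul w k 1, one_nsmul, zero_nsmul]; abel)
  refine hwx fun j => ?_
  have h₁ := congrFun hwn j
  have h₂ := congrFun hsum j
  simp only [Pi.smul_apply, Pi.add_apply, smul_eq_mul] at h₁ h₂ ⊢
  nlinarith [Nat.zero_le (k * w j), Nat.zero_le (a * y j), Nat.zero_le (b * z j)]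
end

section
/- In the glomming setup, every one of the generators x₀ ⊠ y₀, x_i ⊠ y₀ (1 ≤ i ≤ m), and x₀ ⊠ y_j (1 ≤ j ≤ n') is an atom of the glom G(H₁, H₂); in particular x₀ ⊠ y₀ is an atom of G(H₁, H₂). -/
/-- In a normal submonoid, an atom that is a positive multiple of an element of the group
generated by the submonoid is equal to that element. -/
theorem IsAtomOf.multiplier_eq_one {ι : Type*} {H : AddSubmonoid (ι → ℕ)} (hnorm : IsNormal H)
    {x : ι → ℕ} (hx : IsAtomOf H x) {g : ι → ℤ}
    (hg : g ∈ AddSubgroup.closure (natIntMap '' (H : Set (ι → ℕ)))) {r : ℕ} (hr : 0 < r)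
    (hrg : r • g = natIntMap x) : r = 1 := by
  obtain ⟨w, hw, rfl⟩ := hnorm g hg ⟨r, hr, x, hx.1, hrg.symm⟩
  have hxw : x = r • w := by
    funext k
    have h := congrFun hrg k
    simp only [natIntMap, Pi.smul_apply, nsmul_eq_mul] at h
    simp only [Pi.smul_apply, smul_eq_mul]
    exact_mod_cast h.symm
  have hw0 : w ≠ 0 := by
    rintro rfl
    exact hx.2.1 (by simpa using hxw)
  obtain ⟨s, rfl⟩ : ∃ s, r = s + 1 := ⟨r - 1, by omega⟩
  rcases hx.2.2 (s • w) w (H.nsmul_mem hw s) hw (by rw [hxw, succ_nsmul]) with h | h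
  · rcases smul_eq_zero.mp h with h | h
    · omega
    · exact absurd h hw0
  · exact absurd h hw0

/-- Proportional atoms of a normal submonoid are equal. -/
theorem IsAtomOf.eq_of_nsmul_eq {ι : Type*} {H : AddSubmonoid (ι → ℕ)} (hnorm : IsNormal H)
    {x x' : ι → ℕ} (hx : IsAtomOf H x) (hx' : IsAtomOf H x') {p r : ℕ} (hp : 0 < p) (hr : 0 < r)
    (h : p • x = r • x') : x = x' := by
  obtain ⟨d, p', r', hd, hcop, rfl, rfl⟩ := Nat.exists_coprime' (Nat.gcd_pos_of_pos_left r hp)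
  have hp' : 0 < p' := Nat.pos_of_mul_pos_right hp
  have hr' : 0 < r' := Nat.pos_of_mul_pos_right hr
  have hk : ∀ k, (p' : ℤ) * x k = r' * x' k := by
    intro k
    have h1 := congrFun h k
    simp only [Pi.smul_apply, smul_eq_mul] at h1
    have h2 : p' * x k = r' * x' k := Nat.eq_of_mul_eq_mul_left hd (by linarith)
    exact_mod_cast h2
  obtain ⟨u, v, huv⟩ := Nat.isCoprime_iff_coprime.mpr hcop
  have hg : u • natIntMap x' + v • natIntMap x ∈
      AddSubgroup.closure (natIntMap '' (H : Set (ι → ℕ))) :=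
    add_mem (zsmul_mem (AddSubgroup.subset_closure (Set.mem_image_of_mem natIntMap hx'.1)) u)
      (zsmul_mem (AddSubgroup.subset_closure (Set.mem_image_of_mem natIntMap hx.1)) v)
  have hr1 : r' = 1 := hx.multiplier_eq_one hnorm hg hr' <| by
    funext k
    simp only [natIntMap, Pi.smul_apply, Pi.add_apply, nsmul_eq_mul, smul_eq_mul]
    linear_combination (-u) * hk k + (x k : ℤ) * huv
  have hp1 : p' = 1 := hx'.multiplier_eq_one hnorm hg hp' <| by
    funext k
    simp only [natIntMap, Pi.smul_apply, Pi.add_apply, nsmul_eq_mul, smul_eq_mul]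
    linear_combination v * hk k + (x' k : ℤ) * huv
  subst hr1 hp1
  funext k
  exact_mod_cast (by simpa using hk k : (x k : ℤ) = x' k)

/-- If `z ⊠ y₀ = a ⊠ y₀ + x₀ ⊠ b` with `z` and `x₀` atoms, then one of the two summands vanishes,
and the other one is an elementary tensor in the obvious way. -/
theorem IsAtomOf.eq_of_mul_eq_mul_add_mul {ι κ : Type*} [Nonempty ι] [Nonempty κ]
    {H : AddSubmonoid (ι → ℕ)} (hfull : IsFull H) (hnorm : IsNormal H)
    {x₀ z a : ι → ℕ} {y₀ b : κ → ℕ} (hx₀ : IsAtomOf H x₀) (hz : IsAtomOf H z) (ha : a ∈ H)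
    (hx₀pos : ∀ k, 0 < x₀ k) (hy₀pos : ∀ l, 0 < y₀ l)
    (h : ∀ k l, z k * y₀ l = a k * y₀ l + x₀ k * b l) :
    (b = 0 ∧ z = a) ∨ (a = 0 ∧ b = y₀) := by
  obtain ⟨k₀⟩ := ‹Nonempty ι›
  obtain ⟨l₀⟩ := ‹Nonempty κ›
  have hle : a ≤ z := fun k =>
    Nat.le_of_mul_le_mul_right (by rw [h k l₀]; exact Nat.le_add_right _ _) (hy₀pos l₀)
  rcases hz.2.2 a (z - a) ha (hfull a ha z hz.1 hle) (add_tsub_cancel_of_le hle).symm with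
    rfl | h0
  · right
    refine ⟨rfl, ?_⟩
    simp only [Pi.zero_apply, zero_mul, zero_add] at h
    have hb : 0 < b l₀ := by
      obtain ⟨k, hk⟩ := Function.ne_iff.mp hz.2.1
      have hpos := Nat.mul_pos (Nat.pos_of_ne_zero hk) (hy₀pos l₀)
      rw [h k l₀] at hpos
      exact Nat.pos_of_mul_pos_left hpos
    have hzx : z = x₀ := hz.eq_of_nsmul_eq hnorm hx₀ (hy₀pos l₀) hb <| by
      funext k
      simpa [mul_comm] using h k l₀
    funext l
    exact (Nat.eq_of_mul_eq_mul_left (hx₀pos k₀) (by rw [← h k₀ l, hzx])).symm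
  · left
    have hza : z = a := le_antisymm (tsub_eq_zero_iff_le.mp h0) hle
    refine ⟨funext fun l => ?_, hza⟩
    have hl := h k₀ l
    rw [hza] at hl
    have hmul : x₀ k₀ * b l = 0 := by omega
    exact (Nat.mul_eq_zero.mp hmul).resolve_left (hx₀pos k₀).ne'

/-- Every element of the glom has the form `a ⊠ y₀ + x₀ ⊠ b`. -/
theorem exists_of_mem_glom {t₁ t₂ m n' : ℕ} {H₁ : AddSubmonoid (Fin t₁ → ℕ)}
    {H₂ : AddSubmonoid (Fin t₂ → ℕ)} {x : Fin (m + 1) → Fin t₁ → ℕ}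
    {y : Fin (n' + 1) → Fin t₂ → ℕ} (hx : ∀ i, x i ∈ H₁) (hy : ∀ j, y j ∈ H₂)
    {w : Fin t₁ × Fin t₂ → ℕ} (hw : w ∈ glom x y) :
    ∃ a ∈ H₁, ∃ b ∈ H₂, w = outer a (y 0) + outer (x 0) b := by
  induction hw using AddSubmonoid.closure_induction with
  | mem w hw =>
    rcases hw with ⟨i, rfl⟩ | ⟨j, rfl⟩
    · exact ⟨x i, hx i, 0, H₂.zero_mem, by funext p; simp [outer]⟩
    · exact ⟨0, H₁.zero_mem, y j, hy j, by funext p; simp [outer]⟩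
  | zero => exact ⟨0, H₁.zero_mem, 0, H₂.zero_mem, by funext p; simp [outer]⟩
  | add v w _ _ hv hw =>
    obtain ⟨a, ha, b, hb, rfl⟩ := hv
    obtain ⟨a', ha', b', hb', rfl⟩ := hw
    refine ⟨a + a', add_mem ha ha', b + b', add_mem hb hb', ?_⟩
    funext p
    simp only [outer, Pi.add_apply]
    ring

/-- An element of the glom is an atom if, for each expression `a ⊠ y₀ + x₀ ⊠ b` of it, one of
`a`, `b` is zero and the other one is an atom. -/
theorem isAtomOf_glom {t₁ t₂ m n' : ℕ} {H₁ : AddSubmonoid (Fin t₁ → ℕ)}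
    {H₂ : AddSubmonoid (Fin t₂ → ℕ)} {x : Fin (m + 1) → Fin t₁ → ℕ}
    {y : Fin (n' + 1) → Fin t₂ → ℕ} (hx : ∀ i, x i ∈ H₁) (hy : ∀ j, y j ∈ H₂)
    {w : Fin t₁ × Fin t₂ → ℕ} (hw : w ∈ glom x y) (hw0 : w ≠ 0)
    (h : ∀ a ∈ H₁, ∀ b ∈ H₂, w = outer a (y 0) + outer (x 0) b →
      (b = 0 ∧ IsAtomOf H₁ a) ∨ (a = 0 ∧ IsAtomOf H₂ b)) :
    IsAtomOf (glom x y) w := by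
  refine ⟨hw, hw0, fun u v hu hv huv => ?_⟩
  obtain ⟨a, ha, b, hb, rfl⟩ := exists_of_mem_glom hx hy hu
  obtain ⟨a', ha', b', hb', rfl⟩ := exists_of_mem_glom hx hy hv
  have hsum : w = outer (a + a') (y 0) + outer (x 0) (b + b') := by
    rw [huv]
    funext p
    simp only [outer, Pi.add_apply]
    ring
  rcases h _ (add_mem ha ha') _ (add_mem hb hb') hsum with ⟨h0, hat⟩ | ⟨h0, hat⟩
  · obtain ⟨rfl, rfl⟩ := add_eq_zero.mp h0
    rcases hat.2.2 a a' ha ha' rfl with rfl | rfl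
    · left; funext p; simp [outer]
    · right; funext p; simp [outer]
  · obtain ⟨rfl, rfl⟩ := add_eq_zero.mp h0
    rcases hat.2.2 b b' hb hb' rfl with rfl | rfl
    · left; funext p; simp [outer]
    · right; funext p; simp [outer]

theorem glom_generators_are_atoms {t₁ t₂ m n' : ℕ} (ht₁ : 1 ≤ t₁) (ht₂ : 1 ≤ t₂)
    (H₁ : AddSubmonoid (Fin t₁ → ℕ)) (H₂ : AddSubmonoid (Fin t₂ → ℕ))
    (hfull₁ : IsFull H₁) (hnorm₁ : IsNormal H₁)
    (hfull₂ : IsFull H₂) (hnorm₂ : IsNormal H₂)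
    (x : Fin (m + 1) → Fin t₁ → ℕ) (y : Fin (n' + 1) → Fin t₂ → ℕ)
    (hxatom : ∀ i, IsAtomOf H₁ (x i)) (hxinj : Function.Injective x)
    (hx0pos : ∀ k, 0 < x 0 k)
    (hxdiv : ∀ b : Fin t₁ → ℕ, IsAtomOf H₁ b →
      (∃ n : ℕ, 1 ≤ n ∧ DividesIn H₁ b (n • x 0)) → ∃ i, b = x i)
    (hyatom : ∀ j, IsAtomOf H₂ (y j)) (hyinj : Function.Injective y)
    (hy0pos : ∀ l, 0 < y 0 l)
    (hydiv : ∀ b : Fin t₂ → ℕ, IsAtomOf H₂ b →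
      (∃ n : ℕ, 1 ≤ n ∧ DividesIn H₂ b (n • y 0)) → ∃ j, b = y j) :
    (∀ i, IsAtomOf (glom x y) (outer (x i) (y 0))) ∧
    (∀ j, IsAtomOf (glom x y) (outer (x 0) (y j))) ∧
    IsAtomOf (glom x y) (outer (x 0) (y 0)) := by
  have : Nonempty (Fin t₁) := ⟨⟨0, ht₁⟩⟩
  have : Nonempty (Fin t₂) := ⟨⟨0, ht₂⟩⟩
  have hleft : ∀ i, IsAtomOf (glom x y) (outer (x i) (y 0)) := by
    intro i
    refine isAtomOf_glom (fun i => (hxatom i).1) (fun j => (hyatom j).1)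
      (AddSubmonoid.subset_closure (Or.inl ⟨i, rfl⟩)) ?_ fun a ha b _ hab => ?_
    · obtain ⟨k, hk⟩ := Function.ne_iff.mp (hxatom i).2.1
      exact Function.ne_iff.mpr ⟨(k, ⟨0, ht₂⟩), Nat.mul_ne_zero hk (hy0pos _).ne'⟩
    · rcases (hxatom 0).eq_of_mul_eq_mul_add_mul hfull₁ hnorm₁ (hxatom i) ha hx0pos hy0pos
        (fun k l => congrFun hab (k, l)) with ⟨hb, rfl⟩ | ⟨ha, rfl⟩
      · exact Or.inl ⟨hb, hxatom i⟩
      · exact Or.inr ⟨ha, hyatom 0⟩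
  refine ⟨hleft, fun j => ?_, hleft 0⟩
  refine isAtomOf_glom (fun i => (hxatom i).1) (fun j => (hyatom j).1)
    (AddSubmonoid.subset_closure (Or.inr ⟨j, rfl⟩)) ?_ fun a _ b hb hab => ?_
  · obtain ⟨l, hl⟩ := Function.ne_iff.mp (hyatom j).2.1
    exact Function.ne_iff.mpr ⟨(⟨0, ht₁⟩, l), Nat.mul_ne_zero (hx0pos _).ne' hl⟩
  · have hlk : ∀ l k, y j l * x 0 k = b l * x 0 k + y 0 l * a k := by
      intro l k
      have hkl : x 0 k * y j l = a k * y 0 l + x 0 k * b l := congrFun hab (k, l)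
      linarith
    rcases (hyatom 0).eq_of_mul_eq_mul_add_mul hfull₂ hnorm₂ (hyatom j) hb hy0pos hx0pos hlk with
      ⟨ha, hjb⟩ | ⟨hb, rfl⟩
    · exact Or.inr ⟨ha, hjb ▸ hyatom j⟩
    · exact Or.inl ⟨hb, hxatom 0⟩
end

section
/- Let s : ℕ → ℕ (indexed from 1) be a nondecreasing, eventually constant sequence with s 1 = 1 such that s (i+1) − s i ≠ 1 for every i ≥ 1. Then there exist t ≥ 1, a finitely generated normal additive submonoid H of ℕ^t, and an atom a of H such that s_n(a) = s n for every n ≥ 1. -/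
namespace AddSubmonoid

variable {ι κ : Type*} {gen : κ → ι → ℕ}

lemma exists_gen_add_of_mem_closure_range {M : Type*} [AddCommMonoid M] {gen : κ → M} {x : M}
    (hx : x ∈ closure (Set.range gen)) (hx0 : x ≠ 0) :
    ∃ i, ∃ y ∈ closure (Set.range gen), x = gen i + y := by
  induction hx using closure_induction_left with
  | zero => exact absurd rfl hx0
  | add_left x hx y hy _ =>
    obtain ⟨i, rfl⟩ := hx
    exact ⟨i, y, hy, rfl⟩

/-- If the generators form an antichain of nonzero vectors, the atoms are exactly the generators. -/
lemma isAtomOf_closure_range_iff (hne : ∀ i, gen i ≠ 0)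
    (hanti : ∀ i j, gen i ≤ gen j → i = j) (b : ι → ℕ) :
    IsAtomOf (closure (Set.range gen)) b ↔ b ∈ Set.range gen := by
  constructor
  · rintro ⟨hb, hb0, h⟩
    obtain ⟨i, y, hy, rfl⟩ := exists_gen_add_of_mem_closure_range hb hb0
    rcases h _ _ (subset_closure ⟨i, rfl⟩) hy rfl with h | h
    · exact absurd h (hne i)
    · exact ⟨i, by rw [h, add_zero]⟩
  · rintro ⟨i, rfl⟩
    refine ⟨subset_closure ⟨i, rfl⟩, hne i, fun u v hu hv huv => ?_⟩
    by_contra! hcon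
    obtain ⟨j, y, -, rfl⟩ := exists_gen_add_of_mem_closure_range hu hcon.1
    obtain ⟨l, z, -, rfl⟩ := exists_gen_add_of_mem_closure_range hv hcon.2
    have hval (p : ι) : gen i p = gen j p + y p + (gen l p + z p) := congrFun huv p
    obtain rfl : j = i := hanti _ _ fun p => by
      change gen j p ≤ gen i p
      have := hval p
      omega
    obtain rfl : l = j := hanti _ _ fun p => by
      change gen l p ≤ gen j p
      have := hval p
      omega
    exact hne l (funext fun p => by have := hval p; simp only [Pi.zero_apply]; omega)

end AddSubmonoid

section JumpMonoid

variable {ι J : Type*} {k d : J → ℕ} {pt : ι → (j : J) → Fin (d j)}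

/-- The constant vector `1`, together with, for every `j` and `i`, the vector equal to `k j` on the
points whose `j`th coordinate is `i` and zero elsewhere. -/
def jumpGen (k : J → ℕ) (pt : ι → (j : J) → Fin (d j)) : Option (Σ j, Fin (d j)) → ι → ℕ
  | none => 1
  | some x => fun p => if pt p x.1 = x.2 then k x.1 else 0

/-- The submonoid generated by the vectors `jumpGen k pt`. -/
def jumpMonoid (k : J → ℕ) (pt : ι → (j : J) → Fin (d j)) : AddSubmonoid (ι → ℕ) :=
  AddSubmonoid.closure (Set.range (jumpGen k pt))

lemma jumpGen_mem (x : Option (Σ j, Fin (d j))) : jumpGen k pt x ∈ jumpMonoid k pt :=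
  AddSubmonoid.subset_closure ⟨x, rfl⟩

lemma jumpMonoid_fg [Finite J] : (jumpMonoid k pt).FG :=
  (AddSubmonoid.fg_iff _).2 ⟨_, rfl, Set.finite_range _⟩

lemma dividesIn_jumpMonoid_none {n : ℕ} (hn : 1 ≤ n) :
    DividesIn (jumpMonoid k pt) (jumpGen k pt none) (n • jumpGen k pt none) :=
  ⟨(n - 1) • jumpGen k pt none, nsmul_mem (jumpGen_mem _) _, by
    rw [← succ_nsmul', Nat.sub_add_cancel hn]⟩

/-- The vectors of the form `p ↦ n + ∑ j, k j * m j (pt p j)` with integers `n` and `m j i`. -/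
def jumpGroup [Fintype J] (k : J → ℕ) (pt : ι → (j : J) → Fin (d j)) : AddSubgroup (ι → ℤ) where
  carrier := {g | ∃ (n : ℤ) (m : ∀ j, Fin (d j) → ℤ), ∀ p, g p = n + ∑ j, k j * m j (pt p j)}
  zero_mem' := ⟨0, 0, fun p => by simp⟩
  add_mem' := by
    rintro g g' ⟨n, m, h⟩ ⟨n', m', h'⟩
    refine ⟨n + n', m + m', fun p => ?_⟩
    simp only [Pi.add_apply, h, h', mul_add, Finset.sum_add_distrib]
    ring
  neg_mem' := by
    rintro g ⟨n, m, h⟩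
    refine ⟨-n, -m, fun p => ?_⟩
    simp only [Pi.neg_apply, h, mul_neg, Finset.sum_neg_distrib]
    ring

lemma jumpGroup_nonneg_mem [Fintype J] (hpt : Function.Surjective pt) (hd : ∀ j, 2 ≤ d j)
    {g : ι → ℤ} (hg : g ∈ jumpGroup k pt) (hg0 : 0 ≤ g) :
    g ∈ natIntMap '' (jumpMonoid k pt : Set (ι → ℕ)) := by
  obtain ⟨n, m, h⟩ := hg
  have hmin (j : J) : ∃ i, ∀ i', m j i ≤ m j i' :=
    have : Nonempty (Fin (d j)) := ⟨⟨0, by have := hd j; omega⟩⟩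
    Finite.exists_min (m j)
  choose i hi using hmin
  obtain ⟨p₀, hp₀⟩ := hpt i
  have hp₀' := h p₀
  rw [hp₀] at hp₀'
  refine ⟨(g p₀).toNat • jumpGen k pt none +
    ∑ j, ∑ i', (m j i' - m j (i j)).toNat • jumpGen k pt (some ⟨j, i'⟩),
    add_mem (nsmul_mem (jumpGen_mem _) _)
      (sum_mem fun _ _ => sum_mem fun _ _ => nsmul_mem (jumpGen_mem _) _), ?_⟩
  ext p
  have hg₀ : max (g p₀) 0 = g p₀ := max_eq_left (hg0 p₀)
  have hm (j : J) : max (m j (pt p j) - m j (i j)) 0 = m j (pt p j) - m j (i j) :=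
    max_eq_left (sub_nonneg.2 (hi j _))
  simp only [natIntMap, jumpGen, Pi.add_apply, Pi.smul_apply, Pi.one_apply, smul_eq_mul, mul_one,
    Finset.sum_apply, mul_ite, mul_zero, Finset.sum_ite_eq, Finset.mem_univ, if_true]
  push_cast
  simp only [Int.ofNat_toNat, hm, hg₀, sub_mul, Finset.sum_sub_distrib]
  rw [h p, hp₀']
  simp only [mul_comm]
  ring

variable [DecidableEq J]

lemma exists_coord_eq (hpt : Function.Surjective pt) (hd : ∀ j, 2 ≤ d j) (x : Σ j, Fin (d j)) :
    ∃ p, pt p x.1 = x.2 := by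
  obtain ⟨p, hp⟩ := hpt (Function.update (fun j => ⟨0, by have := hd j; omega⟩) x.1 x.2)
  exact ⟨p, by rw [hp, Function.update_self]⟩

lemma exists_coord_ne (hpt : Function.Surjective pt) (hd : ∀ j, 2 ≤ d j) (x : Σ j, Fin (d j)) :
    ∃ p, pt p x.1 ≠ x.2 := by
  have : Nontrivial (Fin (d x.1)) := Fin.nontrivial_iff_two_le.2 (hd _)
  obtain ⟨i, hi⟩ := exists_ne x.2
  obtain ⟨p, hp⟩ := exists_coord_eq hpt hd ⟨x.1, i⟩
  exact ⟨p, fun h => hi (hp.symm.trans h)⟩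

lemma exists_coord_eq_and_ne (hpt : Function.Surjective pt) (hd : ∀ j, 2 ≤ d j)
    {x y : Σ j, Fin (d j)} (hxy : x ≠ y) : ∃ p, pt p x.1 = x.2 ∧ pt p y.1 ≠ y.2 := by
  obtain ⟨j, i⟩ := x
  obtain ⟨j', i'⟩ := y
  by_cases h : j = j'
  · subst h
    obtain ⟨p, hp⟩ := exists_coord_eq hpt hd ⟨j, i⟩
    refine ⟨p, hp, fun h => hxy ?_⟩
    simp only at hp h
    rw [← hp, ← h]
  · obtain ⟨q, hq⟩ := exists_coord_ne hpt hd ⟨j', i'⟩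
    obtain ⟨p, hp⟩ := hpt (Function.update (pt q) j i)
    refine ⟨p, by simp [hp], ?_⟩
    simpa [hp, Function.update_of_ne (Ne.symm h)] using hq

lemma jumpGen_ne_zero (hpt : Function.Surjective pt) (hd : ∀ j, 2 ≤ d j) (hk : ∀ j, 2 ≤ k j)
    (x : Option (Σ j, Fin (d j))) : jumpGen k pt x ≠ 0 := by
  intro h
  rcases x with _ | x
  · obtain ⟨p, -⟩ := hpt fun j => ⟨0, by have := hd j; omega⟩
    simpa [jumpGen] using congrFun h p
  · obtain ⟨p, hp⟩ := exists_coord_eq hpt hd x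
    have := congrFun h p
    simp only [jumpGen, hp, if_true, Pi.zero_apply] at this
    have := hk x.1
    omega

lemma jumpGen_antichain (hpt : Function.Surjective pt) (hd : ∀ j, 2 ≤ d j) (hk : ∀ j, 2 ≤ k j)
    (x y : Option (Σ j, Fin (d j))) (h : jumpGen k pt x ≤ jumpGen k pt y) : x = y := by
  rcases x with _ | x <;> rcases y with _ | y
  · rfl
  · obtain ⟨p, hp⟩ := exists_coord_ne hpt hd y
    simpa [jumpGen, hp] using h p
  · obtain ⟨p, hp⟩ := exists_coord_eq hpt hd x
    have h := h p
    simp only [jumpGen, hp, if_true, Pi.one_apply] at h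
    have := hk x.1
    omega
  · by_contra hxy
    obtain ⟨p, hp, hp'⟩ := exists_coord_eq_and_ne hpt hd (x := x) (y := y) (by simpa using hxy)
    have h := h p
    simp only [jumpGen, hp, hp', if_true, if_false] at h
    have := hk x.1
    omega

lemma isAtomOf_jumpMonoid_iff (hpt : Function.Surjective pt) (hd : ∀ j, 2 ≤ d j)
    (hk : ∀ j, 2 ≤ k j) (b : ι → ℕ) :
    IsAtomOf (jumpMonoid k pt) b ↔ b ∈ Set.range (jumpGen k pt) :=
  AddSubmonoid.isAtomOf_closure_range_iff (jumpGen_ne_zero hpt hd hk)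
    (jumpGen_antichain hpt hd hk) b

lemma dividesIn_jumpMonoid_some_iff (hpt : Function.Surjective pt) (hd : ∀ j, 2 ≤ d j)
    (x : Σ j, Fin (d j)) (n : ℕ) :
    DividesIn (jumpMonoid k pt) (jumpGen k pt (some x)) (n • jumpGen k pt none) ↔ k x.1 ≤ n := by
  constructor
  · rintro ⟨c, -, h⟩
    obtain ⟨p, hp⟩ := exists_coord_eq hpt hd x
    have := congrFun h p
    simp only [jumpGen, hp, if_true, Pi.add_apply, Pi.smul_apply, Pi.one_apply, smul_eq_mul,
      mul_one] at this
    omega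
  · intro h
    obtain ⟨j, i⟩ := x
    refine ⟨(n - k j) • jumpGen k pt none +
        ∑ i' ∈ Finset.univ.erase i, jumpGen k pt (some ⟨j, i'⟩),
      add_mem (nsmul_mem (jumpGen_mem _) _) (sum_mem fun _ _ => jumpGen_mem _), ?_⟩
    rw [add_left_comm, Finset.add_sum_erase Finset.univ
      (fun i' => jumpGen k pt (some ⟨j, i'⟩)) (Finset.mem_univ i)]
    ext p
    simp only [jumpGen, Pi.add_apply, Pi.smul_apply, Pi.one_apply, smul_eq_mul, mul_one,
      Finset.sum_apply, Finset.sum_ite_eq, Finset.mem_univ, if_true]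
    simp only at h
    omega

variable [Fintype J]

lemma sSeq_jumpMonoid (hpt : Function.Surjective pt) (hd : ∀ j, 2 ≤ d j) (hk : ∀ j, 2 ≤ k j)
    {n : ℕ} (hn : 1 ≤ n) :
    sSeq (jumpMonoid k pt) (jumpGen k pt none) n = 1 + ∑ j, if k j ≤ n then d j else 0 := by
  have hset : {b | IsAtomOf (jumpMonoid k pt) b ∧
      DividesIn (jumpMonoid k pt) b (n • jumpGen k pt none)} =
      jumpGen k pt '' (Finset.insertNone ((Finset.univ.filter fun j => k j ≤ n).sigma
        fun j => (Finset.univ : Finset (Fin (d j)))) : Set (Option (Σ j, Fin (d j)))) := by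
    ext b
    simp only [Set.mem_ofPred_eq, isAtomOf_jumpMonoid_iff hpt hd hk, Set.mem_image]
    constructor
    · rintro ⟨⟨x, rfl⟩, h⟩
      refine ⟨x, ?_, rfl⟩
      rcases x with _ | x
      · simp
      · simpa using (dividesIn_jumpMonoid_some_iff hpt hd x n).1 h
    · rintro ⟨x, hx, rfl⟩
      refine ⟨⟨x, rfl⟩, ?_⟩
      rcases x with _ | x
      · exact dividesIn_jumpMonoid_none hn
      · exact (dividesIn_jumpMonoid_some_iff hpt hd x n).2 (by simpa using hx)
  rw [sSeq, hset, Set.ncard_image_of_injective _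
    fun x y h => jumpGen_antichain hpt hd hk x y h.le, Set.ncard_coe_finset,
    Finset.card_insertNone, Finset.card_sigma, Finset.sum_filter, add_comm]
  simp

lemma natIntMap_mem_jumpGroup {h : ι → ℕ} (hh : h ∈ jumpMonoid k pt) :
    natIntMap h ∈ jumpGroup k pt := by
  induction hh using AddSubmonoid.closure_induction with
  | mem x hx =>
    obtain ⟨_ | ⟨j, i⟩, rfl⟩ := hx
    · exact ⟨1, 0, fun p => by simp [natIntMap, jumpGen]⟩
    · refine ⟨0, Pi.single j (Pi.single i 1), fun p => ?_⟩
      rw [Finset.sum_eq_single j (fun j' _ hj => by simp [Pi.single_eq_of_ne hj]) (by simp)]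
      simp [natIntMap, jumpGen, Pi.single_apply]
  | zero => exact (jumpGroup k pt).zero_mem
  | add x y _ _ hx hy =>
    have : natIntMap (x + y) = natIntMap x + natIntMap y := by
      ext p
      simp [natIntMap]
    exact this ▸ add_mem hx hy

lemma jumpMonoid_isNormal (hpt : Function.Surjective pt) (hd : ∀ j, 2 ≤ d j) :
    IsNormal (jumpMonoid k pt) := by
  rintro g hg ⟨N, hN, h, -, hNg⟩
  refine jumpGroup_nonneg_mem hpt hd ((AddSubgroup.closure_le _).2 ?_ hg) fun p => ?_
  · rintro _ ⟨x, hx, rfl⟩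
    exact natIntMap_mem_jumpGroup hx
  · have hp := congrFun hNg p
    simp only [natIntMap, Pi.smul_apply, nsmul_eq_mul] at hp
    have hN' : (0 : ℤ) < N := by exact_mod_cast hN
    exact nonneg_of_mul_nonneg_right (hp ▸ Int.natCast_nonneg (h p)) hN'

end JumpMonoid

/-- An eventually constant nondecreasing sequence is the sum of its jumps. -/
lemma one_add_sum_jumps {s : ℕ → ℕ} {N : ℕ} (hmono : ∀ i : ℕ, 1 ≤ i → s i ≤ s (i + 1))
    (hconst : ∀ n : ℕ, N ≤ n → s n = s N) (h1 : s 1 = 1) {n : ℕ} (hn : 1 ≤ n) :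
    (1 + ∑ j ∈ (Finset.Icc 2 N).filter fun j => s (j - 1) < s j,
      if j ≤ n then s j - s (j - 1) else 0) = s n := by
  rw [Finset.sum_filter_of_ne fun j _ hj => by split_ifs at hj <;> omega]
  induction n, hn using Nat.le_induction with
  | base =>
    rw [Finset.sum_eq_zero fun j hj => if_neg (by rw [Finset.mem_Icc] at hj; omega), h1,
      add_zero]
  | succ n hn ih =>
    have hsplit (j : ℕ) : (if j ≤ n + 1 then s j - s (j - 1) else 0) =
        (if j ≤ n then s j - s (j - 1) else 0) + if j = n + 1 then s (n + 1) - s n else 0 := by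
      rcases lt_trichotomy j (n + 1) with h | rfl | h
      · simp [h.ne, Nat.lt_succ_iff.1 h, h.le]
      · simp
      · simp [h.ne', h.not_ge, show ¬ j ≤ n by omega]
    simp only [hsplit, Finset.sum_add_distrib, Finset.sum_ite_eq', ← add_assoc, ih,
      Finset.mem_Icc]
    have := hmono n hn
    split_ifs with h
    · omega
    · rw [hconst n (by omega), hconst (n + 1) (by omega), add_zero]

theorem realization_no_jumps_of_size_one (s : ℕ → ℕ)
    (hmono : ∀ i : ℕ, 1 ≤ i → s i ≤ s (i + 1))
    (hconst : ∃ N : ℕ, 1 ≤ N ∧ ∀ n : ℕ, N ≤ n → s n = s N)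
    (h1 : s 1 = 1)
    (hjump : ∀ i : ℕ, 1 ≤ i → s (i + 1) - s i ≠ 1) :
    ∃ (t : ℕ), 1 ≤ t ∧ ∃ H : AddSubmonoid (Fin t → ℕ), H.FG ∧ IsNormal H ∧
      ∃ a : Fin t → ℕ, IsAtomOf H a ∧ ∀ n : ℕ, 1 ≤ n → sSeq H a n = s n := by
  obtain ⟨N, -, hconst⟩ := hconst
  set F : Finset ℕ := (Finset.Icc 2 N).filter fun j => s (j - 1) < s j with hF
  let k : F → ℕ := fun j => j
  let d : F → ℕ := fun j => s j - s (j - 1)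
  have hk (j : F) : 2 ≤ k j := (Finset.mem_Icc.1 (Finset.mem_filter.1 j.2).1).1
  have hd (j : F) : 2 ≤ d j := by
    have h2 : 2 ≤ (j : ℕ) := hk j
    have hlt : s (j - 1) < s j := (Finset.mem_filter.1 j.2).2
    have hne := hjump (j - 1) (by omega)
    rw [Nat.sub_add_cancel (by omega)] at hne
    change 2 ≤ s j - s (j - 1)
    omega
  have hpt := (Fintype.equivFin ((j : F) → Fin (d j))).symm.surjective
  have : Nonempty ((j : F) → Fin (d j)) := ⟨fun j => ⟨0, by have := hd j; omega⟩⟩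
  refine ⟨_, Fintype.card_pos (α := (j : F) → Fin (d j)), jumpMonoid k _, jumpMonoid_fg,
    jumpMonoid_isNormal hpt hd, jumpGen k _ none,
    (isAtomOf_jumpMonoid_iff hpt hd hk _).2 ⟨none, rfl⟩, fun n hn => ?_⟩
  rw [sSeq_jumpMonoid hpt hd hk hn, ← one_add_sum_jumps hmono hconst h1 hn, ← hF]
  exact congrArg (1 + ·) (Finset.sum_coe_sort F fun j => if j ≤ n then s j - s (j - 1) else 0)
end

section
/- Let H and K be reduced commutative cancellative monoids and let θ : H → K be a transfer homomorphism. Let a be an atom of H and let n ≥ 1. If every atom of H dividing a^{n+1} also divides a^n, then every atom of K dividing θ(a)^{n+1} also divides θ(a)^n. (In particular, the divisor sequence of θ(a) stabilizes no later than that of a.) -/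
theorem transfer_hom_stabilization {H K : Type*} [CancelCommMonoid H] [CancelCommMonoid K]
    (hHred : ∀ u : H, IsUnit u → u = 1) (hKred : ∀ u : K, IsUnit u → u = 1)
    (θ : H →* K) (hsurj : Function.Surjective θ)
    (hker : ∀ h : H, θ h = 1 → h = 1)
    (hlift : ∀ h : H, ∀ x y : K, θ h = x * y →
      ∃ u v : H, θ u = x ∧ θ v = y ∧ h = u * v)
    (a : H) (ha : IsMulAtom a) (n : ℕ) (hn : 1 ≤ n)
    (hstab : ∀ b : H, IsMulAtom b → b ∣ a ^ (n + 1) → b ∣ a ^ n) :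
    ∀ x : K, IsMulAtom x → x ∣ (θ a) ^ (n + 1) → x ∣ (θ a) ^ n := by
  rintro x ⟨hx1, hx⟩ ⟨c, hc⟩
  obtain ⟨u, v, rfl, -, huv⟩ := hlift (a ^ (n + 1)) x c (by rw [map_pow, hc])
  have hu : IsMulAtom u := by
    refine ⟨fun h => hx1 (by rw [h, map_one]), fun b d hbd => ?_⟩
    exact (hx (θ b) (θ d) (by rw [hbd, map_mul])).imp (hker b) (hker d)
  rw [← map_pow]
  exact map_dvd θ (hstab u hu ⟨v, huv⟩)
end

section
/- Let H and K be reduced commutative cancellative monoids, let θ : H → K be a transfer homomorphism, let a be an atom of H, and let N ≥ 1 be such that for every k ≥ N, every atom of K dividing θ(a)^{k+1} also divides θ(a)^k. If b is an atom of H dividing a^M for some M ≥ N, then there exists an atom x of H such that x divides a^N and θ(x) = θ(b). -/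
/-- Under a homomorphism with trivial fibre over `1` that lifts factorizations,
`h` is an atom exactly when its image is. -/
theorem isMulAtom_map_iff {H K : Type*} [CommMonoid H] [CommMonoid K] (θ : H →* K)
    (hker : ∀ h : H, θ h = 1 → h = 1)
    (hlift : ∀ h : H, ∀ x y : K, θ h = x * y →
      ∃ u v : H, θ u = x ∧ θ v = y ∧ h = u * v) (h : H) :
    IsMulAtom (θ h) ↔ IsMulAtom h := by
  constructor
  · rintro ⟨hne, hfac⟩
    refine ⟨fun h1 => hne (by rw [h1, map_one]), fun c d hcd => ?_⟩
    exact (hfac (θ c) (θ d) (by rw [hcd, map_mul])).imp (hker c) (hker d)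
  · rintro ⟨hne, hfac⟩
    refine ⟨fun h1 => hne (hker h h1), fun x y hxy => ?_⟩
    obtain ⟨u, v, rfl, rfl, huv⟩ := hlift h x y hxy
    exact (hfac u v huv).imp (fun hu => by rw [hu, map_one]) (fun hv => by rw [hv, map_one])

theorem transfer_hom_fibers {H K : Type*} [CancelCommMonoid H] [CancelCommMonoid K]
    (hHred : ∀ u : H, IsUnit u → u = 1) (hKred : ∀ u : K, IsUnit u → u = 1)
    (θ : H →* K) (hsurj : Function.Surjective θ)
    (hker : ∀ h : H, θ h = 1 → h = 1)
    (hlift : ∀ h : H, ∀ x y : K, θ h = x * y →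
      ∃ u v : H, θ u = x ∧ θ v = y ∧ h = u * v)
    (a : H) (ha : IsMulAtom a) (N : ℕ) (hN : 1 ≤ N)
    (hstab : ∀ k : ℕ, N ≤ k → ∀ x : K, IsMulAtom x → x ∣ (θ a) ^ (k + 1) → x ∣ (θ a) ^ k)
    (b : H) (hb : IsMulAtom b) (M : ℕ) (hM : N ≤ M) (hbdvd : b ∣ a ^ M) :
    ∃ x : H, IsMulAtom x ∧ x ∣ a ^ N ∧ θ x = θ b := by
  have hθb : IsMulAtom (θ b) := (isMulAtom_map_iff θ hker hlift b).2 hb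
  have hdvd : θ b ∣ θ a ^ N := by
    have hM_dvd : θ b ∣ θ a ^ M := by simpa using map_dvd θ hbdvd
    clear hbdvd
    induction M, hM using Nat.le_induction with
    | base => exact hM_dvd
    | succ k hk ih => exact ih (hstab k hk (θ b) hθb hM_dvd)
  obtain ⟨y, hy⟩ := hdvd
  obtain ⟨x, v, hx, -, hxv⟩ := hlift (a ^ N) (θ b) y (by rw [map_pow, hy])
  exact ⟨x, (isMulAtom_map_iff θ hker hlift x).1 (hx ▸ hθb), ⟨v, hxv⟩, hx⟩
end
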